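/- arXiv:1503.02827 — 7 statements merged into one kernel-verified Lean document; each statement's English description precedes it below -/
import Mathlib

section
/- Let G be a countable amenable group and let Θ be a continuous action of G by homeomorphisms on a compact metric space X (not necessarily free). Then there exists a compact, zero-dimensional (totally disconnected) metric space Y, a free continuous action of G by homeomorphisms on Y, and a continuous surjection π : Y → X satisfying π(g·y) = g·π(y) for all g ∈ G, y ∈ Y. -/
/-- A fixed-point-free permutation of a countable type admits a proper colouring of its orbit
graph with three colours. -/
theorem exists_fin_three_coloring {α : Type*} [Countable α] (T : Equiv.Perm α)
    (hT : ∀ x, T x ≠ x) : ∃ c : α → Fin 3, ∀ x, c x ≠ c (T x) := by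
  obtain ⟨e, he⟩ := exists_injective_nat α
  have avoid : ∀ a b : Fin 3, ∃ d, d ≠ a ∧ d ≠ b := by decide
  choose m hma hmb using avoid
  have wf : WellFounded fun x y => e x < e y := (measure e).wf
  let step : (x : α) → ((y : α) → e y < e x → Fin 3) → Fin 3 := fun x ih =>
    m (if h : e (T x) < e x then ih _ h else 0) (if h : e (T.symm x) < e x then ih _ h else 0)
  let c : α → Fin 3 := wf.fix step
  have hc : ∀ x, c x = m (if e (T x) < e x then c (T x) else 0)
      (if e (T.symm x) < e x then c (T.symm x) else 0) := fun x => wf.fix_eq step x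
  refine ⟨c, fun x => ?_⟩
  rcases lt_or_gt_of_ne (he.ne (hT x)) with h | h
  · rw [hc x, if_pos h]
    exact hma _ _
  · rw [hc (T x), T.symm_apply_apply, if_pos h]
    exact (hmb _ _).symm

/-- The points of the symbolic extension of `X` built from `f : C → X`: the first coordinate codes
the orbit of a point of `X` through `f`, and the second one is, for each `g ≠ 1`, a colouring of `G`
that distinguishes `h` from `h * g`. -/
def freeCodes {G C X : Type*} [Group G] [MulAction G X] (f : C → X) :
    Set (G → C × (G → Fin 3)) :=
  {y | (∀ h, f (y h).1 = h⁻¹ • f (y 1).1) ∧ ∀ h g, g ≠ 1 → (y h).2 g ≠ (y (h * g)).2 g}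

theorem isClosed_freeCodes {G C X : Type*} [Group G] [TopologicalSpace C] [TopologicalSpace X]
    [T2Space X] [MulAction G X] [ContinuousConstSMul G X] {f : C → X} (hf : Continuous f) :
    IsClosed (freeCodes (G := G) f) := by
  simp only [freeCodes, Set.ofPred_and, Set.ofPred_forall]
  refine IsClosed.inter (isClosed_iInter fun h => ?_)
    (isClosed_iInter fun h => isClosed_iInter fun g => isClosed_iInter fun _ => ?_)
  · exact isClosed_eq (by fun_prop) (by fun_prop)
  · have hcont : Continuous fun y : G → C × (G → Fin 3) => ((y h).2 g, (y (h * g)).2 g) := by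
      fun_prop
    exact (isClosed_discrete {p : Fin 3 × Fin 3 | p.1 ≠ p.2}).preimage hcont

/-- Left translation on the symbolic extension. -/
instance freeCodes.mulAction {G C X : Type*} [Group G] [MulAction G X] (f : C → X) :
    MulAction G (freeCodes (G := G) f) where
  smul k y := ⟨fun h => y.1 (k⁻¹ * h), by
    refine ⟨fun h => ?_, fun h g hg => ?_⟩
    · simp only [y.2.1 (k⁻¹ * _), smul_smul]
      simp
    · simpa [mul_assoc] using y.2.2 (k⁻¹ * h) g hg⟩
  one_smul y := Subtype.ext <| funext fun h => by
    change y.1 (1⁻¹ * h) = y.1 h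
    simp
  mul_smul a b y := Subtype.ext <| funext fun h => by
    change y.1 ((a * b)⁻¹ * h) = y.1 (b⁻¹ * (a⁻¹ * h))
    simp [mul_assoc]

theorem freeCodes.smul_apply {G C X : Type*} [Group G] [MulAction G X] {f : C → X} (k : G)
    (y : freeCodes (G := G) f) (h : G) : (k • y).1 h = y.1 (k⁻¹ * h) := rfl

instance freeCodes.continuousConstSMul {G C X : Type*} [Group G] [MulAction G X]
    [TopologicalSpace C] (f : C → X) : ContinuousConstSMul G (freeCodes (G := G) f) where
  continuous_const_smul k := continuous_induced_rng.2 <| continuous_pi fun h =>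
    (continuous_apply (k⁻¹ * h)).comp continuous_subtype_val

theorem freeCodes.eq_one_of_smul_eq {G C X : Type*} [Group G] [MulAction G X] {f : C → X} {g : G}
    {y : freeCodes (G := G) f} (h : g • y = y) : g = 1 := by
  by_contra hg
  have h1 := congrArg (fun z => (z.1 g).2 g) h
  simp only [freeCodes.smul_apply, inv_mul_cancel] at h1
  exact y.2.2 1 g hg (by simpa using h1)

theorem freeCodes.map_smul {G C X : Type*} [Group G] [MulAction G X] {f : C → X} (g : G)
    (y : freeCodes (G := G) f) : f ((g • y).1 1).1 = g • f (y.1 1).1 := by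
  simp [freeCodes.smul_apply, y.2.1 g⁻¹]

theorem freeCodes.surjective {G C X : Type*} [Group G] [Countable G] [MulAction G X] {f : C → X}
    (hf : Function.Surjective f) :
    Function.Surjective fun y : freeCodes (G := G) f => f (y.1 1).1 := by
  intro x
  have hc : ∀ g : G, ∃ c : G → Fin 3, g ≠ 1 → ∀ h, c h ≠ c (h * g) := fun g => by
    by_cases hg : g = 1
    · exact ⟨0, fun h => (h hg).elim⟩
    · obtain ⟨c, hc⟩ := exists_fin_three_coloring (Equiv.mulRight g) (by simpa using hg)
      exact ⟨c, fun _ => hc⟩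
  choose c hc using hc
  choose s hs using hf
  refine ⟨⟨fun h => (s (h⁻¹ • x), fun g => c g h), fun h => by simp [hs],
    fun h g hg => hc g hg h⟩, by simp [hs]⟩

/-- The extension theorem for a group in the lowest universe. No amenability is needed. -/
theorem exists_zeroDim_free_extension {G : Type} [Group G] [Countable G]
    {X : Type*} [MetricSpace X] [CompactSpace X] [MulAction G X] [ContinuousConstSMul G X] :
    ∃ (Y : Type) (_ : MetricSpace Y) (_ : CompactSpace Y) (_ : TotallyDisconnectedSpace Y)
      (_ : MulAction G Y) (_ : ContinuousConstSMul G Y) (π : Y → X),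
      (∀ (g : G) (y : Y), g • y = y → g = 1) ∧
      Continuous π ∧ Function.Surjective π ∧
      (∀ (g : G) (y : Y), π (g • y) = g • π y) := by
  rcases isEmpty_or_nonempty X with hX | hX
  · let _ : MulAction G Empty :=
      { smul := fun _ y => y, one_smul := fun _ => rfl, mul_smul := fun _ _ _ => rfl }
    exact ⟨Empty, inferInstance, inferInstance, inferInstance, inferInstance,
      ⟨fun _ => continuous_of_discreteTopology⟩, Empty.elim, fun _ y => y.elim,
      continuous_of_discreteTopology, fun x => hX.elim x, fun _ y => y.elim⟩
  · obtain ⟨f, hf, hfs⟩ := exists_nat_bool_continuous_surjective_of_compact X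
    have hcomp : CompactSpace (freeCodes (G := G) f) :=
      isCompact_iff_compactSpace.mp (isClosed_freeCodes hf).isCompact
    exact ⟨freeCodes (G := G) f, TopologicalSpace.metrizableSpaceMetric _, hcomp, inferInstance,
      inferInstance, inferInstance, fun y => f (y.1 1).1,
      fun _ _ => freeCodes.eq_one_of_smul_eq,
      hf.comp (continuous_fst.comp ((continuous_apply 1).comp continuous_subtype_val)),
      freeCodes.surjective hfs,
      freeCodes.map_smul⟩


open scoped Pointwise Classical
open MeasureTheory Filter

/-- `F` is a Følner sequence for the countable group `G`: a sequence of finite nonempty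
subsets such that `|F n △ g • F n| / |F n| → 0` for every `g ∈ G`. -/
def IsFolnerSeq {G : Type*} [Group G] (F : ℕ → Finset G) : Prop :=
  (∀ n, (F n).Nonempty) ∧
  ∀ g : G, Tendsto (fun n => ((symmDiff (F n) ((F n).image (g * ·))).card : ℝ) / (F n).card)
    atTop (nhds 0)

/-- **Zero-dimensional free extensions of amenable group actions.**
If `G` is a countable amenable group acting continuously (by homeomorphisms)
on a compact metric space `X` (not necessarily freely), then there is a compact
zero-dimensional (totally disconnected) metric space `Y`, a free continuous action of `G`
on `Y`, and a continuous equivariant surjection `π : Y → X`. -/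
theorem zeroDim_free_extension
    {G : Type*} [Group G] [Countable G]
    (Fo : ℕ → Finset G) (hFo : IsFolnerSeq Fo)
    {X : Type*} [MetricSpace X] [CompactSpace X]
    [MulAction G X] [ContinuousConstSMul G X] :
    ∃ (Y : Type) (_ : MetricSpace Y) (_ : CompactSpace Y) (_ : TotallyDisconnectedSpace Y)
      (_ : MulAction G Y) (_ : ContinuousConstSMul G Y) (π : Y → X),
      (∀ (g : G) (y : Y), g • y = y → g = 1) ∧
      Continuous π ∧ Function.Surjective π ∧
      (∀ (g : G) (y : Y), π (g • y) = g • π y) := by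
  let e : Shrink.{0} G ≃* G := Shrink.mulEquiv
  have : Countable (Shrink.{0} G) := e.injective.countable
  let _ : MulAction (Shrink.{0} G) X := MulAction.compHom X e.toMonoidHom
  have : ContinuousConstSMul (Shrink.{0} G) X := ⟨fun g => continuous_const_smul (e g)⟩
  obtain ⟨Y, _, hc, ht, _, hs, π, hfree, hπ, hsurj, hequiv⟩ :=
    exists_zeroDim_free_extension (G := Shrink.{0} G) (X := X)
  let _ : MulAction G Y := MulAction.compHom Y e.symm.toMonoidHom
  refine ⟨Y, inferInstance, hc, ht, inferInstance,
    ⟨fun g => continuous_const_smul (e.symm g)⟩, π, fun g y h => ?_, hπ, hsurj, fun g y => ?_⟩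
  · simpa using hfree (e.symm g) y h
  · refine (hequiv (e.symm g) y).trans ?_
    change e (e.symm g) • π y = g • π y
    rw [e.apply_symm_apply]
end

section
/- (Marker lemma) Let X be a compact, zero-dimensional metric space with a continuous free action of a countable amenable group G, and let (F_n) be a Følner sequence for G which is increasing (F_n ⊆ F_{n+1}), contains the neutral element e in every F_n, and satisfies ∪_n F_n = G. Then for every n there exists a clopen set V ⊆ X such that: (1) the sets g(V), g ∈ F_n, are pairwise disjoint; and (2) there exists N ≥ n with ∪_{g ∈ F_N} g(V) = X. -/
open scoped Pointwise Classical
open Filter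

/-- Around every point `x` of a zero-dimensional compact Hausdorff space there is a clopen set
which is disjoint from its translates by the finitely many given elements moving `x`. -/
theorem exists_isClopen_forall_smul_notMem {G X : Type*} [Group G] [TopologicalSpace X]
    [CompactSpace X] [T2Space X] [TotallyDisconnectedSpace X] [MulAction G X]
    [ContinuousConstSMul G X] (T : Finset G) (x : X) (hT : ∀ g ∈ T, g • x ≠ x) :
    ∃ U : Set X, IsClopen U ∧ x ∈ U ∧ ∀ g ∈ T, ∀ y ∈ U, g • y ∉ U := by
  induction T using Finset.induction_on with
  | empty => exact ⟨Set.univ, isClopen_univ, Set.mem_univ x, by simp⟩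
  | insert g T _ ih =>
    obtain ⟨U, hU, hxU, hUT⟩ := ih fun h hh => hT h (Finset.mem_insert_of_mem hh)
    obtain ⟨W, hW, hxW, hgW⟩ := exists_isClopen_of_totally_separated
      (hT g (Finset.mem_insert_self g T)).symm
    refine ⟨U ∩ (W ∩ (g • ·) ⁻¹' Wᶜ),
      hU.inter (hW.inter (hW.compl.preimage (continuous_const_smul g))),
      ⟨hxU, hxW, hgW⟩, ?_⟩
    intro h hh y hy hy'
    rcases Finset.mem_insert.1 hh with rfl | hh
    · exact hy.2.2 hy'.2.1
    · exact hUT h hh y hy.1 hy'.1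

/-- Given finitely many clopen sets, each disjoint from its translates by the nontrivial elements
of a finite symmetric set `S` containing `1`, there is a clopen set with the same property
whose translates by `S` cover all of them. -/
theorem exists_isClopen_forall_smul_notMem_of_finset {G X ι : Type*} [Group G]
    [TopologicalSpace X] [MulAction G X] [ContinuousConstSMul G X] (S : Finset G)
    (hS1 : (1 : G) ∈ S) (hSinv : ∀ g ∈ S, g⁻¹ ∈ S) (U : ι → Set X) (hU : ∀ i, IsClopen (U i))
    (hdisj : ∀ i, ∀ g ∈ S, g ≠ 1 → ∀ y ∈ U i, g • y ∉ U i) (t : Finset ι) :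
    ∃ V : Set X, IsClopen V ∧ (∀ g ∈ S, g ≠ 1 → ∀ y ∈ V, g • y ∉ V) ∧
      ∀ i ∈ t, ∀ x ∈ U i, ∃ g ∈ S, g • x ∈ V := by
  induction t using Finset.induction_on with
  | empty => exact ⟨∅, isClopen_empty, by simp, by simp⟩
  | insert i t _ ih =>
    obtain ⟨V, hV, hVS, hVt⟩ := ih
    refine ⟨V ∪ (U i \ ⋃ g ∈ S, (g • ·) ⁻¹' V), ?_, ?_, ?_⟩
    · exact hV.union ((hU i).diff
        (isClopen_biUnion_finset fun g _ => hV.preimage (continuous_const_smul g)))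
    · rintro g hg hg1 y (hy | ⟨hy, hyV⟩) (hgy | ⟨hgy, hgyV⟩)
      · exact hVS g hg hg1 y hy hgy
      · exact hgyV (Set.mem_iUnion₂.2 ⟨g⁻¹, hSinv g hg, by simpa using hy⟩)
      · exact hyV (Set.mem_iUnion₂.2 ⟨g, hg, hgy⟩)
      · exact hdisj i g hg hg1 y hy hgy
    · intro j hj x hx
      rcases Finset.mem_insert.1 hj with rfl | hj
      · by_cases h : x ∈ ⋃ g ∈ S, (g • ·) ⁻¹' V
        · obtain ⟨g, hg, hgx⟩ := Set.mem_iUnion₂.1 h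
          exact ⟨g, hg, Or.inl hgx⟩
        · exact ⟨1, hS1, Or.inr (by simpa only [one_smul] using ⟨hx, h⟩)⟩
      · obtain ⟨g, hg, hgx⟩ := hVt j hj x hx
        exact ⟨g, hg, Or.inl hgx⟩

/-- **The marker lemma.** Let `X` be a compact zero-dimensional metric space with a
continuous free action of a countable amenable group `G`, and let `(F n)` be an
increasing Følner sequence with `1 ∈ F n` for all `n` and `⋃ n, F n = G`. Then for every
`n` there is a clopen set `V ⊆ X` such that the images `g • V`, `g ∈ F n`, are pairwise
disjoint, and there is `N ≥ n` with `⋃ (g ∈ F N), g • V = X`. -/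
theorem marker_lemma
    {G X : Type*} [Group G] [Countable G]
    [MetricSpace X] [CompactSpace X] [TotallyDisconnectedSpace X]
    [MulAction G X] [ContinuousConstSMul G X]
    (hfree : ∀ (g : G) (x : X), g • x = x → g = 1)
    (Fo : ℕ → Finset G) (hFo : IsFolnerSeq Fo) (hmono : Monotone Fo)
    (hone : ∀ n, (1 : G) ∈ Fo n) (hcover : ∀ g : G, ∃ n, g ∈ Fo n) :
    ∀ n : ℕ, ∃ V : Set X, IsClopen V ∧
      (∀ g ∈ Fo n, ∀ h ∈ Fo n, g ≠ h → Disjoint ((g • ·) '' V) ((h • ·) '' V)) ∧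
      ∃ N ≥ n, (⋃ g ∈ Fo N, (g • ·) '' V) = Set.univ := by
  intro n
  set S : Finset G := (Fo n)⁻¹ * Fo n with hS
  have hmem : ∀ g ∈ Fo n, ∀ h ∈ Fo n, g⁻¹ * h ∈ S := fun g hg h hh =>
    Finset.mul_mem_mul (Finset.inv_mem_inv hg) hh
  have hS1 : (1 : G) ∈ S := by simpa using hmem 1 (hone n) 1 (hone n)
  have hSinv : ∀ g ∈ S, g⁻¹ ∈ S := by
    intro g hg
    obtain ⟨a, ha, b, hb, rfl⟩ := Finset.mem_mul.1 hg
    simpa using hmem b hb a⁻¹ (Finset.mem_inv'.1 ha)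
  choose U hU hxU hdisj using fun x : X =>
    exists_isClopen_forall_smul_notMem (S.erase 1) x fun g hg hgx =>
      Finset.ne_of_mem_erase hg (hfree g x hgx)
  obtain ⟨t, ht⟩ := isCompact_univ.elim_finite_subcover U (fun x => (hU x).isOpen)
    fun x _ => Set.mem_iUnion.2 ⟨x, hxU x⟩
  obtain ⟨V, hV, hVS, hVt⟩ := exists_isClopen_forall_smul_notMem_of_finset S hS1 hSinv U hU
    (fun x g hg hg1 => hdisj x g (Finset.mem_erase.2 ⟨hg1, hg⟩)) t
  refine ⟨V, hV, ?_, ?_⟩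
  · intro g hg h hh hne
    refine Set.disjoint_left.2 ?_
    rintro _ ⟨v, hv, rfl⟩ ⟨w, hw, hwv⟩
    refine hVS (g⁻¹ * h) (hmem g hg h hh) (fun he => hne (inv_mul_eq_one.1 he)) w hw ?_
    have : (g⁻¹ * h) • w = v := by
      rw [mul_smul, inv_smul_eq_iff]
      exact hwv
    rwa [this]
  · choose k hk using hcover
    refine ⟨max n (S.sup k), le_max_left _ _, Set.eq_univ_of_forall fun x => ?_⟩
    obtain ⟨i, hi, hxi⟩ := Set.mem_iUnion₂.1 (ht (Set.mem_univ x))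
    obtain ⟨g, hg, hgx⟩ := hVt i hi x hxi
    have hgN : g⁻¹ ∈ Fo (max n (S.sup k)) :=
      hmono ((Finset.le_sup (hSinv g hg)).trans (le_max_right _ _)) (hk g⁻¹)
    exact Set.mem_iUnion₂.2 ⟨g⁻¹, hgN, g • x, hgx, inv_smul_smul g x⟩
end

section
/- (Quasitiling lemma) Let X be a zero-dimensional compact metric space with a free continuous action of a countable amenable group G, and let (F_n) be a Følner sequence for G which is increasing, contains the neutral element e in every F_n, and satisfies ∪_n F_n = G. For every ε with 0 < ε < 1/2 and every n_0 ∈ ℕ there exist k ≥ 1, indices n_k ≥ n_{k-1} ≥ … ≥ n_1 = n_0 + 1, and maps C_1, …, C_k from X to subsets of G such that (C_1, …, C_k) is a quasitiling of X by the family of sets {F_{n_1}, …, F_{n_k}} which is: ε-disjoint (for every x ∈ X the family of tiles {F_{n_i}c : 1 ≤ i ≤ k, c ∈ C_i(x)} is ε-disjoint); (1−ε)-covering (for every x ∈ X the lower Banach density of ∪_{i=1}^k ∪_{c ∈ C_i(x)} F_{n_i}c is at least 1−ε); dynamical (C_i(g·x) = C_i(x)g^{-1} for all x ∈ X, g ∈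 G, i); and continuous (each map x ↦ C_i(x) is continuous from X into {0,1}^G with the product topology, identifying a subset of G with its indicator function). -/
open scoped Pointwise Classical
open Filter

/-- `D_F(H) = inf_{g ∈ G} |H ∩ Fg| / |F|`. -/
noncomputable def lowerDF {G : Type*} [Group G] (F : Finset G) (H : Set G) : ℝ :=
  ⨅ g : G, (Set.ncard (H ∩ ((· * g) '' (F : Set G))) : ℝ) / (F.card : ℝ)

/-- The lower Banach density `D(H) = sup {D_F(H) : F ⊆ G finite nonempty}`. -/
noncomputable def banachDensity {G : Type*} [Group G] (H : Set G) : ℝ :=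
  ⨆ F : {F : Finset G // F.Nonempty}, lowerDF F.1 H

/-- The tile `T c = {t * c : t ∈ T}`. -/
noncomputable def tile {G : Type*} [Group G] (T : Finset G) (c : G) : Finset G := T.image (· * c)

/-- The points of `X` lying in one of the translates `f • U i`, `f ∈ S i`. -/
def coveredSet {G X : Type*} [Group G] [MulAction G X] (S : ℕ → Finset G) (U : ℕ → Set X) :
    Set X :=
  {x | ∃ i, ∃ f ∈ S i, ∃ y ∈ U i, f • y = x}

/-- Clopen bases `U i` of towers of shapes `S i`, together with large subsets `A i x ⊆ S i` for
`x ∈ U i` whose translates `A i x • x` are pairwise disjoint. -/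
structure IsClopenTowers {G X : Type*} [Group G] [MulAction G X] [TopologicalSpace X]
    (ε : ℝ) (S : ℕ → Finset G) (U : ℕ → Set X) (A : ℕ → X → Finset G) : Prop where
  isClopen : ∀ i, IsClopen (U i)
  isClopen_covered : IsClopen (coveredSet S U)
  subset : ∀ i, ∀ x ∈ U i, A i x ⊆ S i
  card_sdiff_lt : ∀ i, ∀ x ∈ U i, ((S i \ A i x).card : ℝ) < ε * (S i).card
  disjoint : ∀ i j x y f g, x ∈ U i → y ∈ U j → f ∈ A i x → g ∈ A j y → f • x = g • y →
    i = j ∧ x = y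

/-- The elements of `F` moved out of `F` by left multiplication by some element of `K`. -/
noncomputable def leftBoundary {G : Type*} [Group G] (K F : Finset G) : Finset G :=
  F.filter (fun h => ∃ k ∈ K, k * h ∉ F)

section Folner

theorem leftBoundary_mono_left {G : Type*} [Group G] {K K' : Finset G} (h : K ⊆ K')
    (F : Finset G) : leftBoundary K F ⊆ leftBoundary K' F :=
  Finset.monotone_filter_right _ fun _ _ ⟨k, hk, hkx⟩ => ⟨k, h hk, hkx⟩

variable {G : Type*} [Group G] {F : ℕ → Finset G}

theorem IsFolnerSeq.eventually_card_filter_mul_notMem_le (hF : IsFolnerSeq F) (g : G) {η : ℝ}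
    (hη : 0 < η) :
    ∀ᶠ n in atTop, (((F n).filter (fun h => g * h ∉ F n)).card : ℝ) ≤ η * (F n).card := by
  filter_upwards [(hF.2 g).eventually_le_const hη] with n hn
  have hpos : (0 : ℝ) < (F n).card := by exact_mod_cast (hF.1 n).card_pos
  rw [div_le_iff₀ hpos] at hn
  refine le_trans ?_ hn
  rw [← Finset.card_image_of_injective _ (mul_right_injective g)]
  norm_cast
  apply Finset.card_le_card
  intro x hx
  simp only [Finset.mem_image, Finset.mem_filter] at hx
  obtain ⟨h, ⟨hh, hgh⟩, rfl⟩ := hx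
  exact Finset.mem_symmDiff.2 (Or.inr ⟨Finset.mem_image_of_mem _ hh, hgh⟩)

theorem IsFolnerSeq.eventually_card_leftBoundary_le (hF : IsFolnerSeq F) (K : Finset G) {η : ℝ}
    (hη : 0 < η) :
    ∀ᶠ n in atTop, ((leftBoundary K (F n)).card : ℝ) ≤ η * (F n).card := by
  have hpos : (0 : ℝ) < K.card + 1 := by positivity
  filter_upwards [(Filter.eventually_all_finset K).2 fun k _ =>
    hF.eventually_card_filter_mul_notMem_le k (div_pos hη hpos)] with n hn
  have hsub : leftBoundary K (F n) ⊆
      K.biUnion fun k => (F n).filter (fun h => k * h ∉ F n) := by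
    intro h
    simp only [leftBoundary, Finset.mem_filter, Finset.mem_biUnion]
    rintro ⟨hh, k, hk, hkh⟩
    exact ⟨k, hk, hh, hkh⟩
  calc _ ≤ ((∑ k ∈ K, ((F n).filter (fun h => k * h ∉ F n)).card : ℕ) : ℝ) := by
        exact_mod_cast (Finset.card_le_card hsub).trans Finset.card_biUnion_le
    _ ≤ ∑ _k ∈ K, η / (K.card + 1) * (F n).card := by
        push_cast
        exact Finset.sum_le_sum hn
    _ = K.card / (K.card + 1) * (η * (F n).card) := by
        rw [Finset.sum_const, nsmul_eq_mul]; ring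
    _ ≤ 1 * (η * (F n).card) := by
        gcongr
        rw [div_le_one hpos]; linarith
    _ = _ := one_mul _

theorem IsFolnerSeq.eventually_card_mul_le (hF : IsFolnerSeq F) (K : Finset G) :
    ∀ᶠ n in atTop, ((K * F n).card : ℝ) ≤ 2 * (F n).card := by
  have hpos : (0 : ℝ) < K.card + 1 := by positivity
  filter_upwards [(Filter.eventually_all_finset K).2 fun k _ =>
    hF.eventually_card_filter_mul_notMem_le k (one_div_pos.2 hpos)] with n hn
  have hsub : K * F n ⊆
      F n ∪ K.biUnion fun k => ((F n).filter (fun h => k * h ∉ F n)).image (k * ·) := by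
    intro x hx
    obtain ⟨k, hk, h, hh, rfl⟩ := Finset.mem_mul.1 hx
    by_cases hkh : k * h ∈ F n
    · exact Finset.mem_union_left _ hkh
    · exact Finset.mem_union_right _ (Finset.mem_biUnion.2
        ⟨k, hk, Finset.mem_image_of_mem _ (Finset.mem_filter.2 ⟨hh, hkh⟩)⟩)
  have hcard : (K * F n).card ≤
      (F n).card + ∑ k ∈ K, ((F n).filter (fun h => k * h ∉ F n)).card := by
    refine (Finset.card_le_card hsub).trans ((Finset.card_union_le _ _).trans ?_)
    gcongr
    exact Finset.card_biUnion_le.trans (Finset.sum_le_sum fun k _ => Finset.card_image_le)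
  calc ((K * F n).card : ℝ)
      ≤ (F n).card + ∑ k ∈ K, (((F n).filter (fun h => k * h ∉ F n)).card : ℝ) := by
        exact_mod_cast hcard
    _ ≤ (F n).card + ∑ _k ∈ K, 1 / ((K.card : ℝ) + 1) * (F n).card := by
        gcongr with k hk
        exact hn k hk
    _ = (F n).card + K.card / (K.card + 1) * (F n).card := by
        rw [Finset.sum_const, nsmul_eq_mul]; ring
    _ ≤ (F n).card + 1 * (F n).card := by
        gcongr
        rw [div_le_one hpos]; linarith
    _ = _ := by ring

end Folner

section Towers

variable {G X : Type*} [Group G] [MulAction G X]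

theorem coveredSet_mono (S : ℕ → Finset G) {U U' : ℕ → Set X} (h : ∀ i, U i ⊆ U' i) :
    coveredSet S U ⊆ coveredSet S U' := by
  rintro x ⟨i, f, hf, y, hy, rfl⟩
  exact ⟨i, f, hf, y, h i hy, rfl⟩

theorem eq_of_smul_eq_smul_of_free (hfree : ∀ (g : G) (x : X), g • x = x → g = 1) {g h : G}
    {x : X} (hgh : g • x = h • x) : g = h :=
  (inv_mul_eq_one.1 (hfree (g⁻¹ * h) x (by rw [mul_smul, ← hgh, inv_smul_smul])))

theorem isClopen_setOf_card_lt [TopologicalSpace X] [ContinuousConstSMul G X] (F : Finset G)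
    {V : Set X} (hV : IsClopen V) (r : ℝ) :
    IsClopen {x : X | ((F.filter (fun f => f • x ∈ V)).card : ℝ) < r} := by
  have hcont : Continuous fun x : X => (F.filter (fun f => f • x ∈ V)).card := by
    simp only [Finset.card_filter]
    refine continuous_finsetSum _ fun f _ => ?_
    refine Continuous.if ?_ continuous_const continuous_const
    intro a ha
    have hcl : IsClopen {x : X | f • x ∈ V} := hV.preimage (continuous_const_smul f)
    rw [hcl.frontier_eq] at ha
    exact ha.elim
  exact (isClopen_discrete {m : ℕ | (m : ℝ) < r}).preimage hcont

/-- Free continuous actions on zero-dimensional compact spaces: any point has a clopen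
neighbourhood whose translates by a finite set are pairwise disjoint. -/
theorem exists_isClopen_smul_injOn [TopologicalSpace X] [T2Space X] [CompactSpace X]
    [TotallyDisconnectedSpace X] [ContinuousConstSMul G X]
    (hfree : ∀ (g : G) (x : X), g • x = x → g = 1) (F : Finset G) (x : X) :
    ∃ P : Set X, IsClopen P ∧ x ∈ P ∧
      ∀ y ∈ P, ∀ z ∈ P, ∀ f ∈ F, ∀ g ∈ F, f • y = g • z → y = z := by
  have key : ∀ᶠ p : X × X in nhds x ×ˢ nhds x,
      ∀ f ∈ F, ∀ g ∈ F, f • p.1 = g • p.2 → p.1 = p.2 := by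
    refine (Filter.eventually_all_finset F).2 fun f _ =>
      (Filter.eventually_all_finset F).2 fun g _ => ?_
    by_cases hfg : f = g
    · subst hfg
      exact Filter.Eventually.of_forall fun p hp => smul_left_cancel f hp
    · have hne : f • x ≠ g • x := fun h => hfg (eq_of_smul_eq_smul_of_free hfree h)
      rw [← nhds_prod_eq]
      have hopen : IsOpen {p : X × X | f • p.1 ≠ g • p.2} :=
        isOpen_ne_fun (continuous_fst.const_smul f) (continuous_snd.const_smul g)
      filter_upwards [hopen.mem_nhds (show (x, x) ∈ {p : X × X | f • p.1 ≠ g • p.2} from hne)]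
        with p hp h
      exact absurd h hp
  obtain ⟨t, ht, hts⟩ := Filter.mem_prod_self_iff.1 key
  obtain ⟨O, hOt, hO, hxO⟩ := mem_nhds_iff.1 ht
  obtain ⟨P, hP, hxP, hPO⟩ := compact_exists_isClopen_in_isOpen hO hxO
  exact ⟨P, hP, hxP, fun y hy z hz f hf g hg h =>
    hts (Set.mk_mem_prod (hOt (hPO hy)) (hOt (hPO hz))) f hf g hg h⟩

variable {ε : ℝ} {S : ℕ → Finset G}

theorem eventually_card_uncovered_le {F : ℕ → Finset G} (hF : IsFolnerSeq F) {V V' : Set X}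
    (hVV' : V ⊆ V') {K : Finset G} (hK : K.Nonempty) (hε1 : ε ≤ 1)
    (hcov : ∀ x : X, ε * K.card ≤ (K.filter (fun f => f • x ∈ V')).card) {u b δ : ℝ} (hδ : 0 < δ)
    (hu : ∀ᶠ n in atTop, ∀ x : X,
      (((F n).filter (fun g => g • x ∉ V)).card : ℝ) ≤ u * (F n).card)
    (hb : ∀ᶠ n in atTop, ∀ x : X,
      (((F n).filter (fun g => g • x ∈ V ∧ ∃ f ∈ K, f • g • x ∉ V)).card : ℝ) ≤
        b * (F n).card) :
    ∀ᶠ n in atTop, ∀ x : X,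
      (((F n).filter (fun g => g • x ∉ V')).card : ℝ) ≤
        ((1 - ε) * u + b + δ) * (F n).card := by
  filter_upwards [hu, hb, hF.eventually_card_leftBoundary_le K⁻¹ hδ] with n hun hbn hδn x
  have hKpos : (0 : ℝ) < K.card := by exact_mod_cast hK.card_pos
  set N := (F n).filter (fun g => g • x ∉ V') with hN
  set B := (F n).filter (fun g => g • x ∈ V ∧ ∃ f ∈ K, f • g • x ∉ V) with hB
  set W := (F n).filter (fun g => g • x ∉ V) with hW
  have hshift : ∀ f ∈ K, (N.card : ℝ) ≤
      δ * (F n).card + ((F n).filter (fun c => f • c • x ∉ V')).card := by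
    intro f hf
    have hsub : N ⊆ leftBoundary K⁻¹ (F n) ∪
        ((F n).filter (fun c => f • c • x ∉ V')).image (f * ·) := by
      intro g hg
      obtain ⟨hgF, hgV⟩ := Finset.mem_filter.1 hg
      by_cases hfg : f⁻¹ * g ∈ F n
      · refine Finset.mem_union_right _ (Finset.mem_image.2 ⟨f⁻¹ * g,
          Finset.mem_filter.2 ⟨hfg, ?_⟩, mul_inv_cancel_left f g⟩)
        rwa [← mul_smul, mul_inv_cancel_left]
      · exact Finset.mem_union_left _
          (Finset.mem_filter.2 ⟨hgF, f⁻¹, Finset.inv_mem_inv hf, hfg⟩)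
    have h1 : N.card ≤ (leftBoundary K⁻¹ (F n)).card +
        ((F n).filter (fun c => f • c • x ∉ V')).card :=
      (Finset.card_le_card hsub).trans ((Finset.card_union_le _ _).trans
        (Nat.add_le_add_left Finset.card_image_le _))
    have h2 : (N.card : ℝ) ≤ (leftBoundary K⁻¹ (F n)).card +
        ((F n).filter (fun c => f • c • x ∉ V')).card := by exact_mod_cast h1
    linarith
  have hpoint : ∀ c ∈ F n, ((K.filter (fun f => f • c • x ∉ V')).card : ℝ) ≤
      K.card * ((if c • x ∈ V ∧ ∃ f ∈ K, f • c • x ∉ V then 1 else 0) +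
        (1 - ε) * (if c • x ∉ V then 1 else 0)) := by
    intro c _
    by_cases hcV : c • x ∈ V
    · by_cases hbad : ∃ f ∈ K, f • c • x ∉ V
      · rw [if_pos ⟨hcV, hbad⟩, if_neg (not_not.2 hcV)]
        simpa using Finset.card_filter_le K (fun f => f • c • x ∉ V')
      · have : K.filter (fun f => f • c • x ∉ V') = ∅ :=
          Finset.filter_eq_empty_iff.2 fun f hf hfV =>
            hbad ⟨f, hf, fun hfV' => hfV (hVV' hfV')⟩
        simp [this, hcV, hbad]
    · have h1 := hcov (c • x)
      have h2 : ((K.filter (fun f => f • c • x ∈ V')).card : ℝ) +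
          (K.filter (fun f => f • c • x ∉ V')).card = K.card := by
        exact_mod_cast Finset.card_filter_add_card_filter_not (s := K) (fun f => f • c • x ∈ V')
      simp only [hcV, false_and, if_false, not_false_eq_true, if_true]
      linarith
  have hsum : (K.card : ℝ) * N.card ≤
      K.card * (((1 - ε) * u + b + δ) * (F n).card) := by
    calc (K.card : ℝ) * N.card = ∑ _f ∈ K, (N.card : ℝ) := by
          rw [Finset.sum_const, nsmul_eq_mul]
      _ ≤ ∑ f ∈ K, (δ * (F n).card + (((F n).filter (fun c => f • c • x ∉ V')).card : ℝ)) :=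
          Finset.sum_le_sum hshift
      _ = K.card * (δ * (F n).card) +
            ∑ c ∈ F n, ((K.filter (fun f => f • c • x ∉ V')).card : ℝ) := by
          rw [Finset.sum_add_distrib, Finset.sum_const, nsmul_eq_mul]
          congr 1
          simp only [Finset.card_filter, Nat.cast_sum]
          exact Finset.sum_comm
      _ ≤ K.card * (δ * (F n).card) + K.card * (B.card + (1 - ε) * W.card) := by
          gcongr
          refine (Finset.sum_le_sum hpoint).trans_eq ?_
          rw [← Finset.mul_sum, Finset.sum_add_distrib, ← Finset.mul_sum, hB, hW,
            Finset.card_filter, Finset.card_filter]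
          push_cast
          rfl
      _ ≤ K.card * (δ * (F n).card) +
            K.card * (b * (F n).card + (1 - ε) * (u * (F n).card)) := by
          have h1 : 0 ≤ 1 - ε := by linarith
          gcongr
          · exact hbn x
          · exact hun x
      _ = _ := by ring
  exact le_of_mul_le_mul_left hsum hKpos

variable [TopologicalSpace X]

theorem IsClopenTowers.eventually_card_boundary_le {F : ℕ → Finset G} (hF : IsFolnerSeq F)
    (hfree : ∀ (g : G) (x : X), g • x = x → g = 1) {U : ℕ → Set X} {A : ℕ → X → Finset G}
    (hε : ε ≤ 1 / 2) (h : IsClopenTowers ε S U A) {k : ℕ} (hk : ∀ i, k ≤ i → U i = ∅)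
    (K : Finset G) {δ : ℝ} (hδ : 0 ≤ δ)
    (hinv : ∀ i, (U i).Nonempty → ((leftBoundary K (S i)).card : ℝ) ≤ δ * (S i).card) :
    ∀ᶠ n in atTop, ∀ x : X,
      (((F n).filter (fun g => g • x ∈ coveredSet S U ∧
        ∃ f ∈ K, f • g • x ∉ coveredSet S U)).card : ℝ) ≤ 4 * δ * (F n).card := by
  set T : Finset G := (Finset.range k).biUnion S with hT
  have hST : ∀ i, (U i).Nonempty → i < k ∧ S i ⊆ T := by
    intro i hi
    have hik : i < k := by
      by_contra hle
      rw [hk i (not_lt.1 hle)] at hi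
      exact Set.not_nonempty_empty hi
    exact ⟨hik, Finset.subset_biUnion_of_mem S (Finset.mem_range.2 hik)⟩
  filter_upwards [hF.eventually_card_mul_le (T * T⁻¹)] with n hn x
  set I : Finset (ℕ × G) :=
    (Finset.range k ×ˢ (T⁻¹ * F n)).filter (fun p => p.2 • x ∈ U p.1) with hI
  have hUI : ∀ p ∈ I, p.2 • x ∈ U p.1 := fun p hp => (Finset.mem_filter.1 hp).2
  have hsub : (F n).filter (fun g => g • x ∈ coveredSet S U ∧
        ∃ f ∈ K, f • g • x ∉ coveredSet S U) ⊆
      I.biUnion fun p => (leftBoundary K (S p.1)).image (· * p.2) := by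
    intro g hg
    obtain ⟨hgF, ⟨i, s, hs, y, hy, hsy⟩, f, hf, hfg⟩ := Finset.mem_filter.1 hg
    obtain ⟨hik, hiT⟩ := hST i ⟨y, hy⟩
    have hy' : (s⁻¹ * g) • x = y := by rw [mul_smul, ← hsy, inv_smul_smul]
    refine Finset.mem_biUnion.2 ⟨(i, s⁻¹ * g), Finset.mem_filter.2 ⟨Finset.mem_product.2
      ⟨Finset.mem_range.2 hik, Finset.mul_mem_mul (Finset.inv_mem_inv (hiT hs)) hgF⟩, ?_⟩,
      Finset.mem_image.2 ⟨s, Finset.mem_filter.2 ⟨hs, f, hf, fun hfs => hfg ?_⟩,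
        mul_inv_cancel_left s g⟩⟩
    · exact hy'.symm ▸ hy
    · exact ⟨i, f * s, hfs, y, hy, by rw [mul_smul, hsy]⟩
  have hdisj : (I : Set (ℕ × G)).PairwiseDisjoint
      fun p => (A p.1 (p.2 • x)).image (· * p.2) := by
    intro p hp q hq hpq
    refine Finset.disjoint_left.2 fun g hgp hgq => hpq ?_
    obtain ⟨a, ha, rfl⟩ := Finset.mem_image.1 hgp
    obtain ⟨b, hb, hab⟩ := Finset.mem_image.1 hgq
    have := h.disjoint p.1 q.1 (p.2 • x) (q.2 • x) a b (hUI p hp) (hUI q hq) ha hb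
      (by rw [← mul_smul, ← mul_smul]; exact congrArg (· • x) hab.symm)
    exact Prod.ext this.1 (eq_of_smul_eq_smul_of_free hfree this.2)
  have hunion : (I.biUnion fun p => (A p.1 (p.2 • x)).image (· * p.2)) ⊆ T * T⁻¹ * F n := by
    refine Finset.biUnion_subset.2 fun p hp => ?_
    intro g hg
    obtain ⟨a, ha, rfl⟩ := Finset.mem_image.1 hg
    have hpU := hUI p hp
    rw [mul_assoc]
    exact Finset.mul_mem_mul ((hST p.1 ⟨_, hpU⟩).2 (h.subset _ _ hpU ha))
      (Finset.mem_product.1 (Finset.mem_filter.1 hp).1).2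
  have hhalf : ∀ p ∈ I, ((S p.1).card : ℝ) ≤ 2 * (A p.1 (p.2 • x)).card := by
    intro p hp
    have h1 := h.card_sdiff_lt p.1 _ (hUI p hp)
    have h2 : ((S p.1 \ A p.1 (p.2 • x)).card : ℝ) + (A p.1 (p.2 • x)).card = (S p.1).card := by
      exact_mod_cast Finset.card_sdiff_add_card_eq_card (h.subset p.1 _ (hUI p hp))
    have h3 : ε * (S p.1).card ≤ 1 / 2 * (S p.1).card := by gcongr
    linarith
  calc _ ≤ ((∑ p ∈ I, ((leftBoundary K (S p.1)).image (· * p.2)).card : ℕ) : ℝ) := by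
        exact_mod_cast (Finset.card_le_card hsub).trans Finset.card_biUnion_le
    _ ≤ ∑ p ∈ I, 2 * δ * (((A p.1 (p.2 • x)).image (· * p.2)).card : ℝ) := by
        push_cast
        refine Finset.sum_le_sum fun p hp => ?_
        rw [Finset.card_image_of_injective _ (mul_left_injective _),
          Finset.card_image_of_injective _ (mul_left_injective _)]
        calc _ ≤ δ * ((S p.1).card : ℝ) := hinv p.1 ⟨_, hUI p hp⟩
          _ ≤ δ * (2 * (A p.1 (p.2 • x)).card) := by gcongr; exact hhalf p hp
          _ = _ := by ring
    _ = 2 * δ * ((I.biUnion fun p => (A p.1 (p.2 • x)).image (· * p.2)).card : ℝ) := by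
        rw [Finset.card_biUnion hdisj, ← Finset.mul_sum]
        push_cast
        rfl
    _ ≤ 2 * δ * (2 * (F n).card) := by
        gcongr
        exact (Nat.cast_le.2 (Finset.card_le_card hunion)).trans hn
    _ = _ := by ring

variable [ContinuousConstSMul G X]

theorem IsClopenTowers.exists_extend_clopen {U : ℕ → Set X} {A : ℕ → X → Finset G}
    (hε1 : ε ≤ 1) (h : IsClopenTowers ε S U A) (i : ℕ) {P : Set X} (hP : IsClopen P)
    (hinj : ∀ y ∈ P, ∀ z ∈ P, ∀ f ∈ S i, ∀ g ∈ S i, f • y = g • z → y = z) :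
    ∃ U' A', IsClopenTowers ε S U' A' ∧ (∀ j, U j ⊆ U' j) ∧ (∀ j ≠ i, U' j = U j) ∧
      ∀ x ∈ P, ε * (S i).card ≤ ((S i).filter (fun f => f • x ∈ coveredSet S U')).card := by
  set V := coveredSet S U with hV
  set Q : Set X :=
    P ∩ {x | (((S i).filter (fun f => f • x ∈ V)).card : ℝ) < ε * (S i).card} with hQ
  have hQc : IsClopen Q := hP.inter (isClopen_setOf_card_lt _ h.isClopen_covered _)
  set U' : ℕ → Set X := fun j => {x | x ∈ U j ∨ (j = i ∧ x ∈ Q)} with hU'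
  have hUU' : ∀ j, U j ⊆ U' j := fun j x hx => Or.inl hx
  have hcov : coveredSet S U' = V ∪ ⋃ f ∈ S i, (fun x => f⁻¹ • x) ⁻¹' Q := by
    ext x
    simp only [Set.mem_union, Set.mem_iUnion, Set.mem_preimage]
    constructor
    · rintro ⟨j, f, hf, y, hy | ⟨rfl, hy⟩, rfl⟩
      · exact Or.inl ⟨j, f, hf, y, hy, rfl⟩
      · exact Or.inr ⟨f, hf, by rwa [inv_smul_smul]⟩
    · rintro (hx | ⟨f, hf, hx⟩)
      · exact coveredSet_mono S hUU' hx
      · exact ⟨i, f, hf, f⁻¹ • x, Or.inr ⟨rfl, hx⟩, smul_inv_smul f x⟩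
  refine ⟨U', fun j x => if j = i ∧ x ∈ Q then (S i).filter (fun f => f • x ∉ V) else A j x,
    ⟨?_, ?_, ?_, ?_, ?_⟩, hUU', ?_, ?_⟩
  · intro j
    by_cases hj : j = i
    · have : U' j = U j ∪ Q := by ext x; simp [hU', hj]
      rw [this]
      exact (h.isClopen j).union hQc
    · have : U' j = U j := by ext x; simp [hU', hj]
      rw [this]
      exact h.isClopen j
  · rw [hcov]
    refine h.isClopen_covered.union (Set.Finite.isClopen_biUnion (S i).finite_toSet fun f _ => ?_)
    exact hQc.preimage (continuous_const_smul _)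
  · intro j x hx
    by_cases hn : j = i ∧ x ∈ Q
    · obtain ⟨rfl, hxQ⟩ := hn
      simp [hxQ]
    · simp only [hn, if_false]
      exact h.subset j x (hx.resolve_right hn)
  · intro j x hx
    by_cases hn : j = i ∧ x ∈ Q
    · simp only [hn, and_self, if_true]
      have heq : S i \ (S i).filter (fun f => f • x ∉ V) = (S i).filter (fun f => f • x ∈ V) := by
        ext f
        simp only [Finset.mem_sdiff, Finset.mem_filter]
        tauto
      rw [heq]
      exact hn.2.2
    · simp only [hn, if_false]
      exact h.card_sdiff_lt j x (hx.resolve_right hn)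
  · have hcross : ∀ (j : ℕ) (x y : X) (f g : G), f ∈ (S i).filter (fun f => f • x ∉ V) →
        y ∈ U j → g ∈ A j y → f • x ≠ g • y := by
      intro j x y f g hf hy hg hfg
      rw [Finset.mem_filter, hfg] at hf
      exact hf.2 ⟨j, g, h.subset j y hy hg, y, hy, rfl⟩
    intro j l x y f g hx hy hf hg hfg
    by_cases hn : j = i ∧ x ∈ Q <;> by_cases hm : l = i ∧ y ∈ Q
    · simp only [hn, hm, and_self, if_true, Finset.mem_filter] at hf hg
      exact ⟨hn.1.trans hm.1.symm, hinj x hn.2.1 y hm.2.1 f hf.1 g hg.1 hfg⟩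
    · simp only [hn, hm, and_self, if_true, if_false] at hf hg
      exact (hcross l x y f g hf (hy.resolve_right hm) hg hfg).elim
    · simp only [hn, hm, and_self, if_true, if_false] at hf hg
      exact (hcross j y x g f hg (hx.resolve_right hn) hf hfg.symm).elim
    · simp only [hn, hm, if_false] at hf hg
      exact h.disjoint j l x y f g (hx.resolve_right hn) (hy.resolve_right hm) hf hg hfg
  · intro j hj
    ext x
    simp [hU', hj]
  · intro x hx
    by_cases hxQ : x ∈ Q
    · rw [Finset.filter_true_of_mem fun f hf => ⟨i, f, hf, x, Or.inr ⟨rfl, hxQ⟩, rfl⟩]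
      exact mul_le_of_le_one_left (Nat.cast_nonneg _) hε1
    · have hle : ε * (S i).card ≤ ((S i).filter (fun f => f • x ∈ V)).card :=
        not_lt.1 fun hlt => hxQ ⟨hx, hlt⟩
      refine hle.trans ?_
      norm_cast
      exact Finset.card_le_card (Finset.monotone_filter_right _ fun f _ hf =>
        coveredSet_mono S hUU' hf)

theorem IsClopenTowers.exists_extend [T2Space X] [CompactSpace X] [TotallyDisconnectedSpace X]
    (hfree : ∀ (g : G) (x : X), g • x = x → g = 1) {U : ℕ → Set X} {A : ℕ → X → Finset G}
    (hε1 : ε ≤ 1) (h : IsClopenTowers ε S U A) (i : ℕ) :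
    ∃ U' A', IsClopenTowers ε S U' A' ∧ (∀ j, U j ⊆ U' j) ∧ (∀ j ≠ i, U' j = U j) ∧
      ∀ x, ε * (S i).card ≤ ((S i).filter (fun f => f • x ∈ coveredSet S U')).card := by
  choose P hP hxP hinj using exists_isClopen_smul_injOn hfree (S i)
  have key : ∀ t : Finset X, ∃ U' A', IsClopenTowers ε S U' A' ∧ (∀ j, U j ⊆ U' j) ∧
      (∀ j ≠ i, U' j = U j) ∧ ∀ z ∈ t, ∀ x ∈ P z,
        ε * (S i).card ≤ ((S i).filter (fun f => f • x ∈ coveredSet S U')).card := by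
    intro t
    induction t using Finset.induction_on with
    | empty => exact ⟨U, A, h, fun _ => subset_rfl, fun _ _ => rfl, by simp⟩
    | insert z t _ ih =>
      obtain ⟨U₁, A₁, h₁, hsub₁, heq₁, hcov₁⟩ := ih
      obtain ⟨U₂, A₂, h₂, hsub₂, heq₂, hcov₂⟩ := h₁.exists_extend_clopen hε1 i (hP z) (hinj z)
      refine ⟨U₂, A₂, h₂, fun j => (hsub₁ j).trans (hsub₂ j),
        fun j hj => (heq₂ j hj).trans (heq₁ j hj), fun w hw x hx => ?_⟩
      rcases Finset.mem_insert.1 hw with rfl | hw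
      · exact hcov₂ x hx
      · refine (hcov₁ w hw x hx).trans ?_
        norm_cast
        exact Finset.card_le_card (Finset.monotone_filter_right _ fun f _ hf =>
          coveredSet_mono S hsub₂ hf)
  obtain ⟨t, ht⟩ := CompactSpace.elim_nhds_subcover P fun x => (hP x).isOpen.mem_nhds (hxP x)
  obtain ⟨U', A', h', hsub, heq, hcov⟩ := key t
  refine ⟨U', A', h', hsub, heq, fun x => ?_⟩
  have hx : x ∈ ⋃ z ∈ t, P z := ht ▸ trivial
  simp only [Set.mem_iUnion] at hx
  obtain ⟨z, hz, hxz⟩ := hx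
  exact hcov z hz x hxz

theorem exists_isClopenTowers_uncovered_le [T2Space X] [CompactSpace X]
    [TotallyDisconnectedSpace X] {F : ℕ → Finset G} (hF : IsFolnerSeq F)
    (hfree : ∀ (g : G) (x : X), g • x = x → g = 1) (hε0 : 0 < ε) (hε : ε ≤ 1 / 2)
    (hS : ∀ i, (S i).Nonempty) {δ : ℝ} (hδ : 0 < δ)
    (hinv : ∀ j i, j < i → ((leftBoundary (S j) (S i)).card : ℝ) ≤ δ * (S i).card)
    (k s : ℕ) (hs : s ≤ k) :
    ∃ U A, IsClopenTowers (X := X) ε S U A ∧ (∀ i, i < k - s ∨ k ≤ i → U i = ∅) ∧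
      ∀ᶠ n in atTop, ∀ x : X,
        (((F n).filter (fun g => g • x ∉ coveredSet S U)).card : ℝ) ≤
          ((1 - ε) ^ s + 5 * δ / ε) * (F n).card := by
  induction s with
  | zero =>
    have hempty : coveredSet S (fun _ => (∅ : Set X)) = ∅ := by
      ext x; simp [coveredSet]
    refine ⟨fun _ => ∅, fun _ _ => ∅, ⟨fun _ => isClopen_empty, ?_, ?_, ?_, ?_⟩,
      fun _ _ => rfl, Filter.Eventually.of_forall fun n x => ?_⟩
    · rw [hempty]; exact isClopen_empty
    · simp
    · simp
    · simp
    · have h1 : (((F n).filter (fun g => g • x ∉ coveredSet S fun _ => (∅ : Set X))).card : ℝ) ≤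
          (F n).card := by exact_mod_cast Finset.card_filter_le _ _
      have h2 : 0 ≤ 5 * δ / ε * (F n).card := by positivity
      rw [pow_zero, add_mul, one_mul]
      linarith
  | succ s ih =>
    obtain ⟨U, A, h, hU, hu⟩ := ih (by omega)
    obtain ⟨U', A', h', hsub, heq, hcov⟩ :=
      h.exists_extend hfree (by linarith) (k - (s + 1))
    refine ⟨U', A', h', fun i hi => ?_, ?_⟩
    · rw [heq i (by omega), hU i (by omega)]
    · have hb := h.eventually_card_boundary_le hF hfree hε (fun i hi => hU i (Or.inr hi))
        (S (k - (s + 1))) hδ.le fun i hi => hinv _ i (by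
          by_contra hlt
          rw [hU i (by omega)] at hi
          exact Set.not_nonempty_empty hi)
      filter_upwards [eventually_card_uncovered_le hF (coveredSet_mono S hsub) (hS _)
        (by linarith) hcov hδ hu hb] with n hn x
      refine (hn x).trans_eq ?_
      congr 1
      field_simp
      ring

end Towers

theorem IsFolnerSeq.exists_invariant_subseq {G : Type*} [Group G] {F : ℕ → Finset G}
    (hF : IsFolnerSeq F) (hmono : Monotone F) {δ : ℝ} (hδ : 0 < δ) (a : ℕ) :
    ∃ n : ℕ → ℕ, Monotone n ∧ n 0 = a ∧
      ∀ j i, j < i → ((leftBoundary (F (n j)) (F (n i))).card : ℝ) ≤ δ * (F (n i)).card := by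
  have hnext : ∀ m, ∃ l, m ≤ l ∧ ((leftBoundary (F m) (F l)).card : ℝ) ≤ δ * (F l).card :=
    fun m => ((eventually_ge_atTop m).and (hF.eventually_card_leftBoundary_le (F m) hδ)).exists
  choose next hle hinv using hnext
  have hn : Monotone fun i => next^[i] a := monotone_nat_of_le_succ fun i => by
    rw [Function.iterate_succ_apply']
    exact hle _
  refine ⟨fun i => next^[i] a, hn, rfl, fun j i hji => ?_⟩
  obtain ⟨i, rfl⟩ := Nat.exists_eq_succ_of_ne_zero (Nat.ne_zero_of_lt hji)
  simp only [Nat.succ_eq_add_one, Function.iterate_succ_apply']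
  refine le_trans ?_ (hinv (next^[i] a))
  exact_mod_cast Finset.card_le_card
    (leftBoundary_mono_left (hmono (hn (Nat.lt_succ_iff.1 hji))) _)

theorem le_banachDensity {G : Type*} [Group G] {H : Set G} {F : Finset G} (hF : F.Nonempty)
    {r : ℝ} (h : ∀ g : G, r * F.card ≤ (F.filter (fun f => f * g ∈ H)).card) :
    r ≤ banachDensity H := by
  have hcard : ∀ (E : Finset G) (g : G),
      Set.ncard (H ∩ ((· * g) '' (E : Set G))) = (E.filter (fun f => f * g ∈ H)).card := by
    intro E g
    rw [← Finset.card_image_of_injective _ (mul_left_injective g), ← Set.ncard_coe_finset]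
    congr 1
    ext y
    simp only [Set.mem_inter_iff, Set.mem_image, Finset.mem_coe, Finset.mem_image,
      Finset.mem_filter]
    constructor
    · rintro ⟨hy, f, hf, rfl⟩
      exact ⟨f, ⟨hf, hy⟩, rfl⟩
    · rintro ⟨f, ⟨hf, hy⟩, rfl⟩
      exact ⟨hy, f, hf, rfl⟩
  refine le_ciSup_of_le ⟨1, ?_⟩ ⟨F, hF⟩ (le_ciInf fun g => ?_)
  · rintro _ ⟨E, rfl⟩
    refine (ciInf_le ⟨0, ?_⟩ 1).trans ?_
    · rintro _ ⟨g, rfl⟩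
      positivity
    · rw [hcard]
      exact div_le_one_of_le₀ (Nat.cast_le.2 (Finset.card_filter_le _ _)) (Nat.cast_nonneg _)
  · rw [hcard, le_div_iff₀ (by exact_mod_cast hF.card_pos)]
    exact h g

/-- **The quasitiling lemma.** Let `X` be a zero-dimensional compact metric space with a
free continuous action of a countable amenable group `G` with an increasing Følner
sequence `(F n)` containing `1` and exhausting `G`. For every `0 < ε < 1/2` and `n₀`
there are `k ≥ 1`, indices `n (k-1) ≥ ⋯ ≥ n 0 = n₀ + 1` and center maps
`C i : X → Set G` forming a quasitiling of `X` by `{F (n 0), …, F (n (k-1))}` which is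
`ε`-disjoint, `(1-ε)`-covering, dynamical and continuous. -/
theorem quasitiling_lemma
    {G X : Type*} [Group G] [Countable G]
    [MetricSpace X] [CompactSpace X] [TotallyDisconnectedSpace X]
    [MulAction G X] [ContinuousConstSMul G X]
    (hfree : ∀ (g : G) (x : X), g • x = x → g = 1)
    (Fo : ℕ → Finset G) (hFo : IsFolnerSeq Fo) (hmono : Monotone Fo)
    (hone : ∀ n, (1 : G) ∈ Fo n) (hcover : ∀ g : G, ∃ n, g ∈ Fo n)
    (ε : ℝ) (hε0 : 0 < ε) (hε : ε < 1 / 2) (n₀ : ℕ) :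
    ∃ (k : ℕ) (hk : 1 ≤ k) (n : Fin k → ℕ) (C : Fin k → X → Set G),
      Monotone n ∧ n ⟨0, hk⟩ = n₀ + 1 ∧
      -- `ε`-disjointness: for each `x`, the family of tiles `F (n i) • c`, `c ∈ C i x`,
      -- admits pairwise disjoint subsets of relative size at least `1 - ε`
      (∀ x : X, ∃ A : Fin k × G → Finset G,
        (∀ p : Fin k × G, p.2 ∈ C p.1 x →
          A p ⊆ tile (Fo (n p.1)) p.2 ∧
          (((tile (Fo (n p.1)) p.2 \ A p).card : ℝ) < ε * (tile (Fo (n p.1)) p.2).card)) ∧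
        (∀ p q : Fin k × G, p.2 ∈ C p.1 x → q.2 ∈ C q.1 x → p ≠ q →
          Disjoint (A p) (A q))) ∧
      -- `(1-ε)`-covering: the union of all tiles has lower Banach density at least `1 - ε`
      (∀ x : X,
        1 - ε ≤ banachDensity (⋃ i : Fin k, ⋃ c ∈ C i x, (tile (Fo (n i)) c : Set G))) ∧
      -- dynamical: `C i (g • x) = (C i x) g⁻¹`
      (∀ (i : Fin k) (g : G) (x : X), C i (g • x) = (· * g⁻¹) '' C i x) ∧
      -- continuous: `x ↦ C i x ∈ {0,1}^G` is continuous in the product topology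
      (∀ i : Fin k,
        Continuous (fun x : X => (fun g : G => decide (g ∈ C i x)) : X → G → Bool)) := by
  set δ : ℝ := ε ^ 2 / 10 with hδ
  have hδ0 : 0 < δ := by positivity
  obtain ⟨k, hk⟩ := exists_pow_lt_of_lt_one (half_pos hε0) (show 1 - ε < 1 by linarith)
  have hk1 : 1 ≤ k := by
    rcases Nat.eq_zero_or_pos k with rfl | h
    · rw [pow_zero] at hk; linarith
    · exact h
  obtain ⟨n, hn, hn0, hinv⟩ := hFo.exists_invariant_subseq hmono hδ0 (n₀ + 1)
  obtain ⟨U, A, h, hU, hu⟩ := exists_isClopenTowers_uncovered_le (X := X)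
    (S := fun i => Fo (n i)) hFo hfree hε0 hε.le (fun i => hFo.1 (n i)) hδ0 hinv k k le_rfl
  have hmul_inj : ∀ c : G, Function.Injective (· * c) := fun c => mul_left_injective c
  refine ⟨k, hk1, fun i => n i, fun i x => {c | c • x ∈ U i}, fun i j hij => hn hij, hn0,
    fun x => ⟨fun p => tile (A p.1 (p.2 • x)) p.2, fun p hp => ⟨?_, ?_⟩, ?_⟩, fun x => ?_,
    fun i g x => ?_, fun i => ?_⟩
  · exact Finset.image_subset_image (h.subset _ _ hp)
  · simp only [tile]
    rw [← Finset.image_sdiff _ _ (hmul_inj p.2),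
      Finset.card_image_of_injective _ (hmul_inj p.2),
      Finset.card_image_of_injective _ (hmul_inj p.2)]
    exact h.card_sdiff_lt _ _ hp
  · intro p q hp hq hpq
    refine Finset.disjoint_left.2 fun g hgp hgq => hpq ?_
    obtain ⟨a, ha, rfl⟩ := Finset.mem_image.1 hgp
    obtain ⟨b, hb, hab⟩ := Finset.mem_image.1 hgq
    have := h.disjoint p.1 q.1 (p.2 • x) (q.2 • x) a b hp hq ha hb
      (by rw [← mul_smul, ← mul_smul]; exact congrArg (· • x) hab.symm)
    exact Prod.ext (Fin.ext this.1) (eq_of_smul_eq_smul_of_free hfree this.2)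
  · have hmem : ∀ g : G, g • x ∈ coveredSet (fun i => Fo (n i)) U →
        g ∈ ⋃ i : Fin k, ⋃ c ∈ {c : G | c • x ∈ U i}, (tile (Fo (n i)) c : Set G) := by
      rintro g ⟨i, f, hf, y, hy, hfy⟩
      have hik : i < k := by
        by_contra hle
        rw [hU i (Or.inr (not_lt.1 hle))] at hy
        exact hy
      simp only [Set.mem_iUnion]
      refine ⟨⟨i, hik⟩, f⁻¹ * g, ?_, Finset.mem_image.2 ⟨f, hf, mul_inv_cancel_left f g⟩⟩
      change (f⁻¹ * g) • x ∈ U i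
      rwa [mul_smul, ← hfy, inv_smul_smul]
    obtain ⟨m, hm⟩ := hu.exists
    refine le_banachDensity (hFo.1 m) fun g => ?_
    have h1 := hm (g • x)
    have h2 : (((Fo m).filter (fun f => f • g • x ∈ coveredSet (fun i => Fo (n i)) U)).card : ℝ) +
        ((Fo m).filter (fun f => f • g • x ∉ coveredSet (fun i => Fo (n i)) U)).card =
        (Fo m).card := by
      exact_mod_cast Finset.card_filter_add_card_filter_not (s := Fo m)
        (fun f => f • g • x ∈ coveredSet (fun i => Fo (n i)) U)
    have h3 : ((1 - ε) ^ k + 5 * δ / ε) * (Fo m).card ≤ ε * (Fo m).card := by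
      gcongr
      have : 5 * δ / ε = ε / 2 := by rw [hδ]; field_simp; norm_num
      linarith
    refine le_trans (b := (((Fo m).filter
      (fun f => f • g • x ∈ coveredSet (fun i => Fo (n i)) U)).card : ℝ)) (by linarith) ?_
    norm_cast
    refine Finset.card_le_card (Finset.monotone_filter_right _ fun f _ hf => hmem _ ?_)
    rwa [mul_smul]
  · ext c
    simp only [Set.mem_ofPred_eq, Set.mem_image]
    constructor
    · intro hc
      exact ⟨c * g, by rwa [mul_smul], mul_inv_cancel_right c g⟩
    · rintro ⟨d, hd, rfl⟩
      rwa [← mul_smul, inv_mul_cancel_right]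
  · refine continuous_pi fun g => (continuous_bool_rng true).2 ?_
    have : (fun x : X => decide (g ∈ {c : G | c • x ∈ U i})) ⁻¹' {true} =
        (fun x => g • x) ⁻¹' U i := by
      ext x; simp
    rw [this]
    exact (h.isClopen i).preimage (continuous_const_smul g)
end

section
/- Let G be a countable group and (F_n) a Følner sequence for G with e ∈ F_n for all n. Then for every subset H ⊆ G, the sequence D_{F_n}(H) converges and its limit equals the lower Banach density D(H). -/
open scoped Pointwise Classical
open Filter

/-- The part of the translate `F g` lying in `H`, counted by the index set `F`. -/
theorem ncard_inter_image_mul_right {G : Type*} [Group G] (F : Finset G) (H : Set G) (g : G) :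
    Set.ncard (H ∩ ((· * g) '' (F : Set G))) = (F.filter (fun f => f * g ∈ H)).card := by
  rw [← Set.ncard_coe_finset,
    ← Set.ncard_image_of_injective (F.filter (fun f => f * g ∈ H) : Set G) (mul_left_injective g)]
  congr 1
  ext x
  simp only [Set.mem_inter_iff, Set.mem_image, Finset.coe_filter, Set.mem_ofPred_eq,
    Finset.mem_coe]
  constructor
  · rintro ⟨hx, f, hf, rfl⟩
    exact ⟨f, ⟨hf, hx⟩, rfl⟩
  · rintro ⟨f, ⟨hf, hx⟩, rfl⟩
    exact ⟨hx, f, hf, rfl⟩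

theorem bddBelow_range_density {G : Type*} [Group G] (F : Finset G) (H : Set G) :
    BddBelow (Set.range fun g : G =>
      (Set.ncard (H ∩ ((· * g) '' (F : Set G))) : ℝ) / (F.card : ℝ)) :=
  ⟨0, by rintro _ ⟨g, rfl⟩; positivity⟩

theorem lowerDF_le {G : Type*} [Group G] (F : Finset G) (H : Set G) (g : G) :
    lowerDF F H ≤ ((F.filter (fun f => f * g ∈ H)).card : ℝ) / F.card := by
  rw [← ncard_inter_image_mul_right]
  exact ciInf_le (bddBelow_range_density F H) g

theorem le_lowerDF {G : Type*} [Group G] {F : Finset G} {H : Set G} {c : ℝ}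
    (h : ∀ g : G, c ≤ ((F.filter (fun f => f * g ∈ H)).card : ℝ) / F.card) :
    c ≤ lowerDF F H :=
  le_ciInf fun g => by
    rw [ncard_inter_image_mul_right]
    exact h g

theorem lowerDF_le_one {G : Type*} [Group G] (F : Finset G) (H : Set G) : lowerDF F H ≤ 1 :=
  (lowerDF_le F H 1).trans <|
    div_le_one_of_le₀ (by exact_mod_cast Finset.card_filter_le _ _) (by positivity)

theorem lowerDF_le_banachDensity {G : Type*} [Group G] {F : Finset G} (hF : F.Nonempty)
    (H : Set G) : lowerDF F H ≤ banachDensity H :=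
  le_ciSup (f := fun F : {F : Finset G // F.Nonempty} => lowerDF F.1 H)
    ⟨1, by rintro _ ⟨F, rfl⟩; exact lowerDF_le_one F.1 H⟩ ⟨F, hF⟩

/-- Left translating `F` by `k` changes the count of `F g` in `H` by at most `|F ∆ k F|`. -/
theorem card_filter_mul_left_le {G : Type*} [Group G] (F : Finset G) (H : Set G) (k g : G) :
    (F.filter (fun f => k * (f * g) ∈ H)).card ≤
      (F.filter (fun f => f * g ∈ H)).card + (symmDiff F (F.image (k * ·))).card := by
  rw [← Finset.card_image_of_injective _ (mul_right_injective k)]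
  refine (Finset.card_le_card ?_).trans (Finset.card_union_le _ _)
  intro x hx
  obtain ⟨f, hf, rfl⟩ := Finset.mem_image.1 hx
  obtain ⟨hf, hH⟩ := Finset.mem_filter.1 hf
  by_cases hkf : k * f ∈ F
  · exact Finset.mem_union_left _ (Finset.mem_filter.2 ⟨hkf, by rwa [mul_assoc]⟩)
  · exact Finset.mem_union_right _
      (Finset.mem_symmDiff.2 (Or.inr ⟨Finset.mem_image_of_mem _ hf, hkf⟩))

/-- The lower density along `K` exceeds the one along `F` by at most the failure of
`K`-invariance of `F`. -/
theorem lowerDF_sub_sum_le_lowerDF {G : Type*} [Group G] {K F : Finset G} (hK : K.Nonempty)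
    (hF : F.Nonempty) (H : Set G) :
    lowerDF K H - ∑ k ∈ K, ((symmDiff F (F.image (k * ·))).card : ℝ) / F.card ≤
      lowerDF F H := by
  refine le_lowerDF fun g => ?_
  have hK1 : (1 : ℝ) ≤ K.card := by exact_mod_cast hK.card_pos
  have hF0 : (0 : ℝ) < F.card := by exact_mod_cast hF.card_pos
  set S : ℝ := ∑ k ∈ K, ((symmDiff F (F.image (k * ·))).card : ℝ) with hS
  set N : ℝ := ((F.filter (fun f => f * g ∈ H)).card : ℝ) with hN
  have hS0 : 0 ≤ S := Finset.sum_nonneg fun _ _ => Nat.cast_nonneg _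
  have hlower : (F.card : ℝ) * (lowerDF K H * K.card) ≤
      ∑ f ∈ F, ((K.filter (fun k => k * (f * g) ∈ H)).card : ℝ) := by
    rw [← nsmul_eq_mul]
    exact Finset.card_nsmul_le_sum _ _ _ fun f _ =>
      (le_div_iff₀ (by linarith)).1 (lowerDF_le K H (f * g))
  have hswap : ∑ f ∈ F, ((K.filter (fun k => k * (f * g) ∈ H)).card : ℝ) =
      ∑ k ∈ K, ((F.filter (fun f => k * (f * g) ∈ H)).card : ℝ) := by
    simp only [Finset.card_filter, Nat.cast_sum]
    exact Finset.sum_comm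
  have hupper : ∑ k ∈ K, ((F.filter (fun f => k * (f * g) ∈ H)).card : ℝ) ≤
      K.card * N + S := by
    rw [← nsmul_eq_mul, ← Finset.sum_const, hS, ← Finset.sum_add_distrib]
    exact Finset.sum_le_sum fun k _ => by
      rw [hN]
      exact_mod_cast card_filter_mul_left_le F H k g
  have hKS : S ≤ K.card * S := le_mul_of_one_le_left hS0 hK1
  have hmul : (K.card : ℝ) * (F.card * lowerDF K H) ≤ K.card * (N + S) := by linarith
  have hdiv := le_of_mul_le_mul_left hmul (by linarith)
  rw [← Finset.sum_div, ← hS, sub_le_iff_le_add, ← add_div, le_div_iff₀ hF0]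
  linarith

/-- Along any Følner sequence `(F n)` with `1 ∈ F n` for all `n`, the densities
`D_{F n}(H)` converge to the lower Banach density `D(H)`, for every `H ⊆ G`. -/
theorem tendsto_lowerDF_banachDensity
    {G : Type*} [Group G] [Countable G]
    (Fo : ℕ → Finset G) (hFo : IsFolnerSeq Fo) (hone : ∀ n, (1 : G) ∈ Fo n)
    (H : Set G) :
    Tendsto (fun n => lowerDF (Fo n) H) atTop (nhds (banachDensity H)) := by
  have : Nonempty {F : Finset G // F.Nonempty} := ⟨⟨Fo 0, hFo.1 0⟩⟩
  refine tendsto_order.2 ⟨fun a ha => ?_, fun a ha =>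
    Eventually.of_forall fun n => (lowerDF_le_banachDensity (hFo.1 n) H).trans_lt ha⟩
  obtain ⟨⟨K, hK⟩, haK⟩ := exists_lt_of_lt_ciSup ha
  have hlim : Tendsto (fun n => lowerDF K H -
      ∑ k ∈ K, ((symmDiff (Fo n) ((Fo n).image (k * ·))).card : ℝ) / (Fo n).card)
      atTop (nhds (lowerDF K H)) := by
    simpa using tendsto_const_nhds.sub (tendsto_finsetSum K fun k _ => hFo.2 k)
  filter_upwards [hlim.eventually_const_lt haK] with n hn
  exact hn.trans_le (lowerDF_sub_sum_le_lowerDF hK (hFo.1 n) H)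
end

section
/- Let G be a group with neutral element e, let E_1 ⊆ E_2 ⊆ … ⊆ E_k be finite subsets of G with e ∈ E_1, and let C_1, …, C_k be subsets of G. For every ε > 0 there exists δ > 0 (depending only on ε and E_k) such that: for every finite nonempty set F ⊆ G which is (E_k E_k^{-1}, δ)-invariant, the union E' of all sets of the form E_i c (with 1 ≤ i ≤ k, c ∈ C_i) that lie on the boundary of F satisfies |E' ∩ F| < ε|F|. -/
open scoped Pointwise Classical

/-- A point of `F` lying in a right translate `A c` that leaves `F` is in `A A⁻¹ (A A⁻¹ F \ F)`. -/
theorem mem_mul_sdiff_of_translate_on_boundary {G : Type*} [Group G] {A F : Finset G} {c h : G}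
    (hh : h ∈ A.image (· * c)) (hF : h ∈ F) (hout : (A.image (· * c) \ F).Nonempty) :
    h ∈ (A * A⁻¹) * (((A * A⁻¹) * F) \ F) := by
  obtain ⟨y, hy⟩ := hout
  obtain ⟨hyA, hyF⟩ := Finset.mem_sdiff.1 hy
  obtain ⟨a, ha, rfl⟩ := Finset.mem_image.1 hh
  obtain ⟨b, hb, rfl⟩ := Finset.mem_image.1 hyA
  have hD : ∀ x ∈ A, ∀ z ∈ A, x * z⁻¹ ∈ A * A⁻¹ := fun x hx z hz =>
    Finset.mul_mem_mul hx (Finset.inv_mem_inv hz)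
  refine Finset.mem_mul.2 ⟨a * b⁻¹, hD a ha b hb, b * c, Finset.mem_sdiff.2 ⟨?_, hyF⟩, by group⟩
  exact Finset.mem_mul.2 ⟨b * a⁻¹, hD b hb a ha, a * c, hF, by group⟩

/-- **Small boundary lemma.** Let `E 0 ⊆ E 1 ⊆ ⋯ ⊆ E (k-1)` be finite subsets of `G` with
`1 ∈ E 0`. For every `ε > 0` there is `δ > 0` (depending only on `ε` and `E (k-1)`) such
that for all center sets `C i ⊆ G` and every finite nonempty set `F` which is
`(E_k E_k⁻¹, δ)`-invariant, the union `E'` of the tiles `(E i) c` (`c ∈ C i`) lying on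
the boundary of `F` (i.e. meeting both `F` and its complement) satisfies
`|E' ∩ F| < ε |F|`. -/
theorem boundary_tiles_small
    {G : Type*} [Group G] (k : ℕ) (hk : 0 < k)
    (E : Fin k → Finset G) (hmono : Monotone E) (hone : (1 : G) ∈ E ⟨0, hk⟩)
    (ε : ℝ) (hε : 0 < ε) :
    ∃ δ > (0 : ℝ), ∀ (C : Fin k → Set G) (F : Finset G), F.Nonempty →
      ((symmDiff F
          ((E ⟨k - 1, Nat.sub_lt hk one_pos⟩ * (E ⟨k - 1, Nat.sub_lt hk one_pos⟩)⁻¹) * F)).card : ℝ)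
        ≤ δ * F.card →
      ((Set.ncard
          ({h : G | ∃ (i : Fin k), ∃ c ∈ C i,
              h ∈ (E i).image (· * c) ∧
              ((E i).image (· * c) ∩ F).Nonempty ∧
              ((E i).image (· * c) \ F).Nonempty} ∩ (F : Set G)) : ℝ))
        < ε * F.card := by
  set A := E ⟨k - 1, Nat.sub_lt hk one_pos⟩
  set D := A * A⁻¹
  have hpos : (0 : ℝ) < D.card + 1 := by positivity
  refine ⟨ε / (D.card + 1), by positivity, fun C F hF hinv => ?_⟩
  have hFpos : (0 : ℝ) < F.card := by exact_mod_cast hF.card_pos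
  have hle : ∀ i, E i ⊆ A := fun i => hmono (Fin.mk_le_mk.2 (Nat.le_sub_one_of_lt i.isLt))
  have hsub : {h : G | ∃ (i : Fin k), ∃ c ∈ C i,
      h ∈ (E i).image (· * c) ∧
      ((E i).image (· * c) ∩ F).Nonempty ∧
      ((E i).image (· * c) \ F).Nonempty} ∩ (F : Set G) ⊆ ((D * ((D * F) \ F) : Finset G) : Set G) := by
    rintro h ⟨⟨i, c, -, hh, -, hout⟩, hhF⟩
    have himage := Finset.image_subset_image (f := (· * c)) (hle i)
    exact mem_mul_sdiff_of_translate_on_boundary (himage hh) hhF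
      (hout.mono (Finset.sdiff_subset_sdiff himage subset_rfl))
  have hcard := Set.ncard_le_ncard hsub (Finset.finite_toSet _)
  rw [Set.ncard_coe_finset] at hcard
  have hdiff : ((D * F) \ F).card ≤ (symmDiff F (D * F)).card :=
    Finset.card_le_card (le_sup_right (a := F \ (D * F)))
  have hnat := hcard.trans (Finset.card_mul_le.trans (Nat.mul_le_mul_left D.card hdiff))
  calc _ ≤ (D.card : ℝ) * (symmDiff F (D * F)).card := by exact_mod_cast hnat
    _ ≤ D.card * (ε / (D.card + 1) * F.card) := by gcongr
    _ = D.card / (D.card + 1) * (ε * F.card) := by ring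
    _ < 1 * (ε * F.card) := by
        gcongr
        rw [div_lt_one hpos]
        exact lt_add_one _
    _ = ε * F.card := one_mul _
end

section
/- Let G be a group, Λ a finite alphabet, and ε ∈ (0,1). For every finite nonempty set A ⊆ G there exists δ > 0 with the following property. Suppose E ⊆ G is a finite nonempty (A,δ)-invariant set, C ⊆ G is such that the tiles Ec (c ∈ C) are pairwise disjoint, and F ⊆ G is a finite nonempty set such that the union of those tiles Ec (c ∈ C) that are contained in F has cardinality at least (1 − 2ε/3)|F| (in particular at least one tile is contained in F; let m ≥ 1 be the number of c ∈ C with Ec ⊆ F). Then for every y : G → Λ and every block Q : A → Λ, the frequency of Q in the block y|_F differs by at most ε from the average over all c ∈ C with Ec ⊆ F of the frequency of Q in the block y|_{Ec}: |fr_{y|F}(Q) − (1/m) Σ_{c ∈ C, Ec ⊆ F} fr_{y|Ec}(Q)| ≤ ε. -/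
open scoped Pointwise Classical

/-- The frequency of the block `Q` (with domain `A`) in the block `y|_B`:
`|{g ∈ B : A g ⊆ B ∧ ∀ a ∈ A, y (a g) = Q a}| / |B|`. -/
noncomputable def freq {G Λ : Type*} [Group G] (A B : Finset G) (Q y : G → Λ) : ℝ :=
  ((B.filter fun g => A.image (· * g) ⊆ B ∧ ∀ a ∈ A, y (a * g) = Q a).card : ℝ) / B.card

/-- The points of `B` at which the block `Q` with domain `A` occurs in `y|_B`. -/
noncomputable def occurrences {G Λ : Type*} [Group G] (A B : Finset G) (Q y : G → Λ) : Finset G :=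
  B.filter fun g => A.image (· * g) ⊆ B ∧ ∀ a ∈ A, y (a * g) = Q a

/-- The points `g` of `B` for which `A g` is not contained in `B`. -/
noncomputable def exteriorPoints {G : Type*} [Group G] (A B : Finset G) : Finset G :=
  B.filter fun g => ¬ A.image (· * g) ⊆ B

lemma occurrences_subset {G Λ : Type*} [Group G] (A B : Finset G) (Q y : G → Λ) :
    occurrences A B Q y ⊆ B :=
  Finset.filter_subset _ _

lemma occurrences_mono {G Λ : Type*} [Group G] (A : Finset G) {B F : Finset G} (h : B ⊆ F)
    (Q y : G → Λ) : occurrences A B Q y ⊆ occurrences A F Q y := by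
  intro g hg
  simp only [occurrences, Finset.mem_filter] at hg ⊢
  exact ⟨h hg.1, hg.2.1.trans h, hg.2.2⟩

lemma card_exteriorPoints_le {G : Type*} [Group G] (A E : Finset G) :
    (exteriorPoints A E).card ≤ A.card * ((A * E) \ E).card := by
  have hsub : exteriorPoints A E ⊆ A⁻¹ * ((A * E) \ E) := by
    intro g hg
    simp only [exteriorPoints, Finset.mem_filter, Finset.image_subset_iff, not_forall] at hg
    obtain ⟨hgE, a, ha, hag⟩ := hg
    refine Finset.mem_mul.2 ⟨a⁻¹, Finset.inv_mem_inv ha, a * g, ?_, inv_mul_cancel_left a g⟩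
    exact Finset.mem_sdiff.2 ⟨Finset.mul_mem_mul ha hgE, hag⟩
  calc (exteriorPoints A E).card ≤ (A⁻¹ * ((A * E) \ E)).card := Finset.card_le_card hsub
    _ ≤ A⁻¹.card * ((A * E) \ E).card := Finset.card_mul_le
    _ = A.card * ((A * E) \ E).card := by rw [Finset.card_inv]

lemma card_exteriorPoints_translate_le {G : Type*} [Group G] (A E : Finset G) (c : G) :
    (exteriorPoints A (E.image (· * c))).card ≤ (exteriorPoints A E).card := by
  refine (Finset.card_le_card ?_).trans
    (Finset.card_image_le (s := exteriorPoints A E) (f := (· * c)))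
  intro g hg
  simp only [exteriorPoints, Finset.mem_filter] at hg
  obtain ⟨hgE, hA⟩ := hg
  obtain ⟨x, hx, rfl⟩ := Finset.mem_image.1 hgE
  refine Finset.mem_image_of_mem _ (Finset.mem_filter.2 ⟨hx, fun h => hA ?_⟩)
  refine Finset.image_subset_iff.2 fun a ha => ?_
  exact Finset.mem_image.2 ⟨a * x, h (Finset.mem_image_of_mem _ ha), mul_assoc a x c⟩

lemma card_translate {G : Type*} [Group G] (E : Finset G) (c : G) :
    (E.image (· * c)).card = E.card :=
  Finset.card_image_of_injective _ (mul_left_injective c)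

/-- An occurrence in `F` lies outside the tiles, or is an occurrence within its tile,
or is an exterior point of its tile. -/
lemma occurrences_subset_of_tiles {G Λ : Type*} [Group G] (A F D : Finset G)
    (T : G → Finset G) (Q y : G → Λ) :
    occurrences A F Q y ⊆ (F \ D.biUnion T) ∪
      ((D.biUnion fun c => occurrences A (T c) Q y) ∪
        D.biUnion fun c => exteriorPoints A (T c)) := by
  intro g hg
  simp only [occurrences, Finset.mem_filter] at hg
  by_cases hU : g ∈ D.biUnion T
  · obtain ⟨c, hc, hgc⟩ := Finset.mem_biUnion.1 hU
    refine Finset.mem_union_right _ ?_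
    by_cases hi : A.image (· * g) ⊆ T c
    · exact Finset.mem_union_left _
        (Finset.mem_biUnion.2 ⟨c, hc, Finset.mem_filter.2 ⟨hgc, hi, hg.2.2⟩⟩)
    · exact Finset.mem_union_right _
        (Finset.mem_biUnion.2 ⟨c, hc, Finset.mem_filter.2 ⟨hgc, hi⟩⟩)
  · exact Finset.mem_union_left _ (Finset.mem_sdiff.2 ⟨hg.1, hU⟩)

lemma abs_div_sub_div_le {ε N n f u : ℝ} (hε : 0 < ε) (hu : 0 < u) (huf : u ≤ f)
    (hcov : (1 - 2 * ε / 3) * f ≤ u) (hn : 0 ≤ n) (hnu : n ≤ u) (hnN : n ≤ N)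
    (hN : N ≤ (f - u) + (n + ε / 3 * u)) : |N / f - n / u| ≤ ε := by
  have hf : 0 < f := hu.trans_le huf
  have h1 : n / f ≤ n / u := div_le_div_of_nonneg_left hn hu huf
  have h2 : N / f - n / f ≤ ε := by
    rw [← sub_div, div_le_iff₀ hf]
    nlinarith
  have h3 : n / f ≤ N / f := div_le_div_of_nonneg_right hnN hf.le
  have h4 : n / u - n / f ≤ ε := by
    have h5 : n / u - n / f = n / u * ((f - u) / f) := by
      field_simp
    have h6 : n / u ≤ 1 := (div_le_one hu).2 hnu
    have h7 : (f - u) / f ≤ ε := by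
      rw [div_le_iff₀ hf]
      nlinarith
    have h8 : 0 ≤ (f - u) / f := div_nonneg (sub_nonneg.2 huf) hf.le
    rw [h5]
    exact (mul_le_of_le_one_left h8 h6).trans h7
  rw [abs_le]
  constructor <;> linarith

/-- **The frequency lemma.** Let `Λ` be a finite alphabet and `ε ∈ (0,1)`. For every
finite nonempty `A ⊆ G` there is `δ > 0` such that: whenever `E` is a finite nonempty
`(A,δ)`-invariant set, `C ⊆ G` is such that the tiles `E c`, `c ∈ C`, are pairwise
disjoint, `F` is a finite nonempty set, and `D` is the (finite) set of `c ∈ C` with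
`E c ⊆ F`, if the union of the tiles `E c`, `c ∈ D`, has cardinality at least
`(1 - 2ε/3)|F|`, then `D` is nonempty and for every point `y : G → Λ` and every block
`Q` with domain `A`, the frequency of `Q` in `y|_F` differs by at most `ε` from the
average of the frequencies of `Q` in the blocks `y|_{E c}`, `c ∈ D`. -/
theorem frequency_lemma
    {G Λ : Type*} [Group G] [Fintype Λ]
    (ε : ℝ) (hε0 : 0 < ε) (hε1 : ε < 1)
    (A : Finset G) (hA : A.Nonempty) :
    ∃ δ > (0 : ℝ),
      ∀ E : Finset G, E.Nonempty →
        ((symmDiff E (A * E)).card : ℝ) ≤ δ * E.card →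
      ∀ C : Set G,
        (∀ c ∈ C, ∀ c' ∈ C, c ≠ c' → Disjoint (E.image (· * c)) (E.image (· * c'))) →
      ∀ F : Finset G, F.Nonempty →
      ∀ D : Finset G, (D : Set G) = {c ∈ C | E.image (· * c) ⊆ F} →
        (1 - 2 * ε / 3) * F.card ≤ ((D.biUnion fun c => E.image (· * c)).card : ℝ) →
        D.Nonempty ∧
        ∀ y Q : G → Λ,
          |freq A F Q y - (1 / D.card) * ∑ c ∈ D, freq A (E.image (· * c)) Q y| ≤ ε := by
  have hA0 : (0 : ℝ) < A.card := Nat.cast_pos.2 hA.card_pos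
  refine ⟨ε / (3 * A.card), by positivity, ?_⟩
  intro E hE hinv C hC F hF D hD hcov
  have hE0 : (0 : ℝ) < E.card := Nat.cast_pos.2 hE.card_pos
  have hF0 : (0 : ℝ) < F.card := Nat.cast_pos.2 hF.card_pos
  have hmem : ∀ c ∈ D, c ∈ C ∧ E.image (· * c) ⊆ F := fun c hc => by
    have : c ∈ (D : Set G) := hc
    rwa [hD] at this
  have hdisj : ∀ c ∈ D, ∀ c' ∈ D, c ≠ c' →
      Disjoint (E.image (· * c)) (E.image (· * c')) :=
    fun c hc c' hc' => hC c (hmem c hc).1 c' (hmem c' hc').1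
  have hDne : D.Nonempty := by
    rw [Finset.nonempty_iff_ne_empty]
    rintro rfl
    simp only [Finset.biUnion_empty, Finset.card_empty, Nat.cast_zero] at hcov
    nlinarith
  refine ⟨hDne, fun y Q => ?_⟩
  have hm0 : (0 : ℝ) < D.card := Nat.cast_pos.2 hDne.card_pos
  have hUF : (D.biUnion fun c => E.image (· * c)) ⊆ F :=
    Finset.biUnion_subset.2 fun c hc => (hmem c hc).2
  have hUcard : (D.biUnion fun c => E.image (· * c)).card = D.card * E.card := by
    rw [Finset.card_biUnion hdisj, Finset.sum_congr rfl fun c _ => card_translate E c,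
      Finset.sum_const, smul_eq_mul]
  have hOcc : (D.biUnion fun c => occurrences A (E.image (· * c)) Q y).card =
      ∑ c ∈ D, (occurrences A (E.image (· * c)) Q y).card :=
    Finset.card_biUnion fun c hc c' hc' hne =>
      (hdisj c hc c' hc' hne).mono (occurrences_subset A _ Q y) (occurrences_subset A _ Q y)
  have hext : (A.card : ℝ) * ((A * E) \ E).card ≤ ε / 3 * E.card := by
    have hle : (((A * E) \ E).card : ℝ) ≤ ε / (3 * A.card) * E.card := by
      refine le_trans (Nat.cast_le.2 (Finset.card_le_card ?_)) hinv
      exact Finset.subset_union_right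
    calc (A.card : ℝ) * ((A * E) \ E).card ≤ A.card * (ε / (3 * A.card) * E.card) := by gcongr
      _ = ε / 3 * E.card := by field_simp
  have hextU : ((D.biUnion fun c => exteriorPoints A (E.image (· * c))).card : ℝ) ≤
      ε / 3 * (D.card * E.card) := by
    have hnat : (D.biUnion fun c => exteriorPoints A (E.image (· * c))).card ≤
        D.card * (A.card * ((A * E) \ E).card) :=
      Finset.card_biUnion_le_card_mul _ _ _ fun c _ =>
        (card_exteriorPoints_translate_le A E c).trans (card_exteriorPoints_le A E)
    calc ((D.biUnion fun c => exteriorPoints A (E.image (· * c))).card : ℝ)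
        ≤ D.card * (A.card * ((A * E) \ E).card) := by exact_mod_cast hnat
      _ ≤ D.card * (ε / 3 * E.card) := by gcongr
      _ = ε / 3 * (D.card * E.card) := by ring
  have havg : (1 / D.card : ℝ) * ∑ c ∈ D, freq A (E.image (· * c)) Q y =
      ((D.biUnion fun c => occurrences A (E.image (· * c)) Q y).card : ℝ) /
        (D.card * E.card) := by
    have hfreq : ∀ c ∈ D, freq A (E.image (· * c)) Q y =
        ((occurrences A (E.image (· * c)) Q y).card : ℝ) / E.card := fun c _ => by
      rw [freq, card_translate, occurrences]
    rw [Finset.sum_congr rfl hfreq, ← Finset.sum_div, hOcc, Nat.cast_sum,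
      one_div_mul_eq_div, div_div, mul_comm (E.card : ℝ)]
  have hsdiff : ((F \ D.biUnion fun c => E.image (· * c)).card : ℝ) =
      F.card - D.card * E.card := by
    rw [Finset.cast_card_sdiff hUF, hUcard, Nat.cast_mul]
  have hfreqF : freq A F Q y = ((occurrences A F Q y).card : ℝ) / F.card := rfl
  rw [havg, hfreqF]
  refine abs_div_sub_div_le hε0 (by positivity) ?_ ?_ (Nat.cast_nonneg _) ?_ ?_ ?_
  · exact_mod_cast hUcard ▸ Finset.card_le_card hUF
  · rw [hUcard] at hcov
    exact_mod_cast hcov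
  · have hsub : (D.biUnion fun c => occurrences A (E.image (· * c)) Q y) ⊆
        D.biUnion fun c => E.image (· * c) :=
      Finset.biUnion_mono fun c _ => occurrences_subset A _ Q y
    exact_mod_cast hUcard ▸ Finset.card_le_card hsub
  · exact Nat.cast_le.2 (Finset.card_le_card (Finset.biUnion_subset.2 fun c hc =>
      occurrences_mono A (hmem c hc).2 Q y))
  · have hcard := (Finset.card_le_card (occurrences_subset_of_tiles A F D
      (fun c => E.image (· * c)) Q y)).trans ((Finset.card_union_le _ _).trans
        (Nat.add_le_add_left (Finset.card_union_le _ _) _))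
    have hcast : ((occurrences A F Q y).card : ℝ) ≤ _ := Nat.cast_le.2 hcard
    rw [Nat.cast_add, Nat.cast_add, hsdiff] at hcast
    linarith
end

section
/- Let G be a countable amenable group with Følner sequence (F_n) (e ∈ F_n for all n). Let X and Y be compact metric spaces with continuous actions Θ^X and Θ^Y of G by homeomorphisms, and endow the spaces of Borel probability measures with the weak-star topology. Let μ be a Θ^X-invariant Borel probability measure on X, let λ be a Θ^Y-invariant Borel probability measure on Y, and assume: (i) the systems are disjoint in the sense that every (Θ^X × Θ^Y)-invariant Borel probability measure on X × Y whose marginals are μ and λ equals the product measure μ ⊗ λ; (ii) t ∈ Y is a generic point for λ along (F_n), i.e. the averages (1/|F_n|) Σ_{g ∈ F_n} δ_{g·t} converge weak-star to λ. Then for every open neighborhood U of μ ⊗ λ in the space of Borel probability measures on X × Y there exist an open neighborhood U_μ of μ in the space of Borel probability measures on X and a number N such that for all n > N and all x ∈ X: if (1/|F_n|) Σ_{g ∈ F_n} δ_{g·x} ∈ U_μ, then (1/|F_n|) Σ_{g ∈ F_n} δ_{(g·x, g·t)} ∈ U. -/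
open scoped Pointwise Classical ENNReal
open MeasureTheory Filter

/-- The empirical (Birkhoff) average `A_F(δ_z) = (1/|F|) ∑_{g ∈ F} δ_{g z}`
of Dirac measures along a finite set `F ⊆ G`, for the action `act`. -/
noncomputable def birkhoff {G Z : Type*} [Group G] [MeasurableSpace Z]
    (act : G → Z → Z) (F : Finset G) (z : Z) : Measure Z :=
  ((F.card : ℝ≥0∞))⁻¹ • ∑ g ∈ F, Measure.dirac (act g z)

theorem birkhoff_isProbabilityMeasure {G Z : Type*} [Group G] [MeasurableSpace Z]
    (act : G → Z → Z) (F : Finset G) (hF : F.Nonempty) (z : Z) :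
    IsProbabilityMeasure (birkhoff act F z) := by
  constructor
  rw [birkhoff, Measure.smul_apply]
  have h2 : (∑ g ∈ F, Measure.dirac (act g z)) Set.univ = (F.card : ℝ≥0∞) := by
    rw [Measure.coe_finset_sum, Finset.sum_apply]
    rw [Finset.sum_congr rfl fun g _ =>
      (measure_univ : Measure.dirac (act g z) Set.univ = 1)]
    simp
  rw [h2, smul_eq_mul, ENNReal.inv_mul_cancel]
  · exact_mod_cast Finset.card_ne_zero.mpr hF
  · exact ENNReal.natCast_ne_top _

/-- The empirical average as a probability measure. -/
noncomputable def birkhoffP {G Z : Type*} [Group G] [MeasurableSpace Z]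
    (act : G → Z → Z) (F : Finset G) (hF : F.Nonempty) (z : Z) : ProbabilityMeasure Z :=
  ⟨birkhoff act F z, birkhoff_isProbabilityMeasure act F hF z⟩

lemma Finset.abs_sum_sub_sum_le_card_symmDiff {α : Type*} (A B : Finset α) (f : α → ℝ) (C : ℝ)
    (hf : ∀ a, |f a| ≤ C) :
    |∑ a ∈ A, f a - ∑ a ∈ B, f a| ≤ (symmDiff B A).card * C := by
  rw [← Finset.sum_sdiff_sub_sum_sdiff]
  have hsum : ∀ S : Finset α, |∑ a ∈ S, f a| ≤ S.card * C := fun S => by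
    refine (Finset.abs_sum_le_sum_abs _ _).trans ?_
    simpa using Finset.sum_le_card_nsmul S (fun a => |f a|) C fun a _ => hf a
  have hcard : (symmDiff B A).card = (B \ A).card + (A \ B).card :=
    Finset.card_union_of_disjoint disjoint_sdiff_sdiff
  rw [hcard, Nat.cast_add, add_mul]
  refine (abs_sub _ _).trans ?_
  linarith [hsum (A \ B), hsum (B \ A)]

section Birkhoff

variable {G Z W : Type*} [Group G] [MeasurableSpace Z] [MeasurableSpace W]

lemma integral_birkhoff [MeasurableSingletonClass Z] (act : G → Z → Z) (F : Finset G) (z : Z)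
    (f : Z → ℝ) :
    ∫ x, f x ∂(birkhoff act F z) = (F.card : ℝ)⁻¹ * ∑ g ∈ F, f (act g z) := by
  rw [birkhoff, integral_smul_measure,
    integral_finsetSum_measure fun g _ => integrable_dirac enorm_lt_top]
  simp

lemma map_birkhoff {act : G → Z → Z} {act' : G → W → W} (F : Finset G) {π : Z → W}
    (hπ : Measurable π) (hact : ∀ g z, π (act g z) = act' g (π z)) (z : Z) :
    (birkhoff act F z).map π = birkhoff act' F (π z) := by
  simp_rw [birkhoff, ← Measure.mapₗ_apply_of_measurable hπ, map_smul, map_sum,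
    Measure.mapₗ_apply_of_measurable hπ, Measure.map_dirac' hπ, hact]

end Birkhoff

/-- Weak-star limits of empirical averages along a Følner sequence are invariant, even if the
base point is allowed to vary. -/
lemma map_smul_eq_of_tendsto_birkhoffP {G Z ι : Type*} [Group G] [TopologicalSpace Z]
    [HasOuterApproxClosed Z] [MeasurableSpace Z] [BorelSpace Z] [MeasurableSingletonClass Z]
    [MulAction G Z] [ContinuousConstSMul G Z]
    {Fo : ℕ → Finset G} (hFo : IsFolnerSeq Fo) (hne : ∀ n, (Fo n).Nonempty)
    {L : Filter ι} [L.NeBot] {N : ι → ℕ} (hN : Tendsto N L atTop) {z : ι → Z}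
    {ρ : ProbabilityMeasure Z}
    (hρ : Tendsto (fun i => birkhoffP (fun (g : G) (z : Z) => g • z) (Fo (N i)) (hne (N i)) (z i))
      L (nhds ρ)) (g : G) :
    Measure.map (fun z : Z => g • z) ρ = ρ := by
  have hg : Continuous fun z : Z => g • z := continuous_const_smul g
  have := Measure.isProbabilityMeasure_map (μ := (ρ : Measure Z)) hg.measurable.aemeasurable
  refine ext_of_forall_integral_eq_of_IsFiniteMeasure fun f => ?_
  rw [integral_map hg.measurable.aemeasurable f.continuous.aestronglyMeasurable]
  rw [ProbabilityMeasure.tendsto_iff_forall_integral_tendsto] at hρ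
  have h1 := hρ f
  have h2 := hρ (f.compContinuous ⟨_, hg⟩)
  have h3 := ((hFo.2 g).comp hN).mul_const ‖f‖
  rw [zero_mul] at h3
  refine sub_eq_zero.1 (tendsto_nhds_unique (h2.sub h1) (squeeze_zero_norm (fun i => ?_) h3))
  simp only [birkhoffP, ProbabilityMeasure.coe_mk, integral_birkhoff, Function.comp_apply,
    BoundedContinuousFunction.compContinuous_apply, ContinuousMap.coe_mk]
  have himage : ∑ h ∈ Fo (N i), f (g • h • z i)
      = ∑ h ∈ (Fo (N i)).image (g * ·), f (h • z i) := by
    rw [Finset.sum_image fun a _ b _ hab => mul_left_cancel hab]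
    simp [mul_smul]
  rw [himage, ← mul_sub, norm_mul, norm_inv, Real.norm_natCast, div_mul_eq_mul_div,
    inv_mul_eq_div, Real.norm_eq_abs]
  gcongr
  exact Finset.abs_sum_sub_sum_le_card_symmDiff _ _ _ _ fun h => f.norm_coe_le_norm _

/-- **Generic points of product systems.** Let `G` be a countable amenable group with a
Følner sequence `(F n)`, acting continuously on compact metric spaces `X` and `Y`, let
`μ` and `lam` be invariant probability measures on `X` and `Y` which are disjoint (every
invariant joining with marginals `μ` and `lam` is the product `μ ⊗ lam`), and let
`t ∈ Y` be generic for `lam` along `(F n)`. Then for every neighborhood `U` of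
`μ ⊗ lam` there are a neighborhood `U_μ` of `μ` and `N` such that for all `n > N` and
`x ∈ X`: if the empirical average of `x` along `F n` lies in `U_μ`, then the empirical
average of `(x, t)` lies in `U`. -/
theorem generic_product_lemma
    {G X Y : Type*} [Group G] [Countable G]
    [MetricSpace X] [CompactSpace X] [MeasurableSpace X] [BorelSpace X]
    [MetricSpace Y] [CompactSpace Y] [MeasurableSpace Y] [BorelSpace Y]
    [MulAction G X] [ContinuousConstSMul G X]
    [MulAction G Y] [ContinuousConstSMul G Y]
    (Fo : ℕ → Finset G) (hFo : IsFolnerSeq Fo) (hne : ∀ n, (Fo n).Nonempty)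
    (hone : ∀ n, (1 : G) ∈ Fo n)
    (μ : Measure X) (hμP : IsProbabilityMeasure μ)
    (hμ : ∀ g : G, Measure.map (fun x : X => g • x) μ = μ)
    (lam : Measure Y) (hlamP : IsProbabilityMeasure lam)
    (hlam : ∀ g : G, Measure.map (fun y : Y => g • y) lam = lam)
    (hdisj : ∀ ρ : Measure (X × Y), IsProbabilityMeasure ρ →
      (∀ g : G, Measure.map (fun p : X × Y => (g • p.1, g • p.2)) ρ = ρ) →
      Measure.map Prod.fst ρ = μ → Measure.map Prod.snd ρ = lam → ρ = μ.prod lam)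
    (t : Y)
    (hgen : Tendsto (fun n => birkhoffP (fun (g : G) (y : Y) => g • y) (Fo n) (hne n) t)
      atTop (nhds ⟨lam, hlamP⟩)) :
    ∀ U : Set (ProbabilityMeasure (X × Y)), IsOpen U →
      (⟨μ.prod lam, by have := hμP; have := hlamP; infer_instance⟩ : ProbabilityMeasure (X × Y)) ∈ U →
      ∃ (Uμ : Set (ProbabilityMeasure X)) (N : ℕ), IsOpen Uμ ∧
        (⟨μ, hμP⟩ : ProbabilityMeasure X) ∈ Uμ ∧
        ∀ n > N, ∀ x : X,
          birkhoffP (fun (g : G) (x : X) => g • x) (Fo n) (hne n) x ∈ Uμ →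
          birkhoffP (fun (g : G) (p : X × Y) => (g • p.1, g • p.2)) (Fo n) (hne n) (x, t) ∈ U := by
  intro U hU hμU
  set bX : ℕ × X → ProbabilityMeasure X := fun p =>
    birkhoffP (fun (g : G) (x : X) => g • x) (Fo p.1) (hne p.1) p.2
  set bXY : ℕ × X → ProbabilityMeasure (X × Y) := fun p =>
    birkhoffP (fun (g : G) (q : X × Y) => (g • q.1, g • q.2)) (Fo p.1) (hne p.1) (p.2, t)
  have hlim : Tendsto bXY (comap Prod.fst atTop ⊓ comap bX (nhds ⟨μ, hμP⟩))
      (nhds ⟨μ.prod lam, inferInstance⟩) := by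
    rw [tendsto_iff_ultrafilter]
    intro V hV
    obtain ⟨ρ, -, hρ⟩ := isCompact_univ.ultrafilter_le_nhds (V.map bXY) (by simp)
    replace hρ : Tendsto bXY V (nhds ρ) := hρ
    have hN : Tendsto Prod.fst (V : Filter (ℕ × X)) atTop :=
      tendsto_iff_comap.2 (hV.trans inf_le_left)
    have hX : Tendsto bX V (nhds ⟨μ, hμP⟩) := tendsto_iff_comap.2 (hV.trans inf_le_right)
    have hfst : Measure.map Prod.fst (ρ : Measure (X × Y)) = μ := by
      refine congrArg ProbabilityMeasure.toMeasure (tendsto_nhds_unique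
        (ProbabilityMeasure.tendsto_map_of_tendsto_of_continuous _ _ hρ continuous_fst)
        (hX.congr fun p => Subtype.ext ?_))
      exact (map_birkhoff (act := fun (g : G) (q : X × Y) => (g • q.1, g • q.2))
        (act' := fun (g : G) (x : X) => g • x) (Fo p.1) measurable_fst (fun _ _ => rfl)
        (p.2, t)).symm
    have hsnd : Measure.map Prod.snd (ρ : Measure (X × Y)) = lam := by
      refine congrArg ProbabilityMeasure.toMeasure (tendsto_nhds_unique
        (ProbabilityMeasure.tendsto_map_of_tendsto_of_continuous _ _ hρ continuous_snd)
        ((hgen.comp hN).congr fun p => Subtype.ext ?_))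
      exact (map_birkhoff (act := fun (g : G) (q : X × Y) => (g • q.1, g • q.2))
        (act' := fun (g : G) (y : Y) => g • y) (Fo p.1) measurable_snd (fun _ _ => rfl)
        (p.2, t)).symm
    have hinv := map_smul_eq_of_tendsto_birkhoffP hFo hne hN hρ
    have hρeq : ρ = ⟨μ.prod lam, inferInstance⟩ :=
      Subtype.ext (hdisj ρ inferInstance hinv hfst hsnd)
    exact hρeq ▸ hρ
  obtain ⟨A, hA, B, hB, hAB⟩ := mem_inf_iff_superset.1 (hlim (hU.mem_nhds hμU))
  obtain ⟨A', hA', hAA'⟩ := mem_comap.1 hA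
  obtain ⟨N, hN⟩ := mem_atTop_sets.1 hA'
  obtain ⟨B', hB', hBB'⟩ := mem_comap.1 hB
  obtain ⟨Uμ, hUμB, hUμ, hμUμ⟩ := mem_nhds_iff.1 hB'
  refine ⟨Uμ, N, hUμ, hμUμ, fun n hn x hx => ?_⟩
  have hA_mem : (n, x) ∈ A := hAA' (hN n hn.le)
  have hB_mem : (n, x) ∈ B := hBB' (hUμB hx)
  have hAB_mem : bXY (n, x) ∈ U := hAB (show (n, x) ∈ A ∩ B from ⟨hA_mem, hB_mem⟩)
  exact hAB_mem
end
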